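/- arXiv:2305.06192 — 5 statements merged into one kernel-verified Lean document; each statement's English description precedes it below -/
import Mathlib

section
/- Let d ≥ 2. Let φ : EuclideanSpace ℝ (Fin d) → ℝ be continuously differentiable with |φ(x)| ≤ C·(1+‖x‖)^{1−d} and ‖∇φ(x)‖ ≤ C·(1+‖x‖)^{-d}, and let S : ℝ^d → ℝ^d be continuously differentiable with div S = 0 and ‖S(x)‖ ≤ C·(1+‖x‖)^{-d}, for all x and some constant C ≥ 0. Set F = ∇φ + S. Then for every orthonormal basis (ω, ω_1, …, ω_{d−1}) of ℝ^d and every p ∈ ℝ, the componentwise Radon transform of the solenoidal part is recovered from the longitudinal transforms of F: ∫_{y ∈ (ℝ∙ω)ᗮ} S(p•ω+y) dy = Σ_{j=1}^{d−1} (∫_{y ∈ (ℝ∙ω)ᗮ} ⟪ω_j, F(p•ω+y)⟫ dy) • ω_j. -/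
open MeasureTheory Real
open scoped RealInnerProductSpace

noncomputable section

/-- The `j`-th canonical basis vector of `ℝ^d`. -/
def canE (d : ℕ) (j : Fin d) : EuclideanSpace ℝ (Fin d) := EuclideanSpace.single j 1

/-- Divergence of a vector field on `ℝ^d`: `div F x = ∑ⱼ ∂Fⱼ/∂xⱼ (x)`. -/
def vdiv {d : ℕ} (F : EuclideanSpace ℝ (Fin d) → EuclideanSpace ℝ (Fin d))
    (x : EuclideanSpace ℝ (Fin d)) : ℝ :=
  ∑ j, fderiv ℝ (fun y => ⟪canE d j, F y⟫) x (canE d j)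

/-- Laplacian of a scalar function on `ℝ^d` (sum of second partial derivatives). -/
def lap {d : ℕ} (f : EuclideanSpace ℝ (Fin d) → ℝ) (x : EuclideanSpace ℝ (Fin d)) : ℝ :=
  ∑ j, fderiv ℝ (fun y => fderiv ℝ f y (canE d j)) x (canE d j)

/-- A function is a Schwartz function if it agrees with an element of the Schwartz space. -/
def IsSchwartz {d : ℕ} (f : EuclideanSpace ℝ (Fin d) → ℝ) : Prop :=
  ∃ g : SchwartzMap (EuclideanSpace ℝ (Fin d)) ℝ, ∀ x, f x = g x

/-- The fundamental solution of the Laplace equation in `ℝ^d`, `d ≥ 3`: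
`G(x) = −(Γ(d/2−1)/(4 π^{d/2})) ‖x‖^{2−d}`. -/
def fundSol (d : ℕ) (x : EuclideanSpace ℝ (Fin d)) : ℝ :=
  -(Real.Gamma ((d : ℝ) / 2 - 1) / (4 * Real.pi ^ ((d : ℝ) / 2))) * ‖x‖ ^ ((2 : ℝ) - d)

/-- The Radon transform of a scalar function: integral over the hyperplane `⟪x,ω⟫ = p`,
parametrized as `x = p•ω + y`, `y ∈ (ℝ∙ω)ᗮ`. -/
def RadonT {d : ℕ} (f : EuclideanSpace ℝ (Fin d) → ℝ) (ω : EuclideanSpace ℝ (Fin d))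
    (p : ℝ) : ℝ :=
  ∫ y : ((ℝ ∙ ω)ᗮ : Submodule ℝ (EuclideanSpace ℝ (Fin d))),
    f (p • ω + (y : EuclideanSpace ℝ (Fin d)))

/-- The componentwise (vector-valued, Bochner) Radon transform of a vector field. -/
def RadonVec {d : ℕ} (F : EuclideanSpace ℝ (Fin d) → EuclideanSpace ℝ (Fin d))
    (ω : EuclideanSpace ℝ (Fin d)) (p : ℝ) : EuclideanSpace ℝ (Fin d) :=
  ∫ y : ((ℝ ∙ ω)ᗮ : Submodule ℝ (EuclideanSpace ℝ (Fin d))),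
    F (p • ω + (y : EuclideanSpace ℝ (Fin d)))

/-- The transversal Radon transform `[D^⊥F](ω,p)`. -/
def Dperp {d : ℕ} (F : EuclideanSpace ℝ (Fin d) → EuclideanSpace ℝ (Fin d))
    (ω : EuclideanSpace ℝ (Fin d)) (p : ℝ) : ℝ :=
  RadonT (fun x => ⟪ω, F x⟫) ω p

/-- The longitudinal Radon transform `[D_θ^∥F](ω,p)` for a direction `θ` orthogonal to `ω`. -/
def Dlong {d : ℕ} (F : EuclideanSpace ℝ (Fin d) → EuclideanSpace ℝ (Fin d))
    (ω θ : EuclideanSpace ℝ (Fin d)) (p : ℝ) : ℝ :=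
  RadonT (fun x => ⟪θ, F x⟫) ω p

/-- The weighted transversal Radon transform `[W_θ^⊥F](ω,p)` with linear weight `⟪θ,x⟫`. -/
def Wperp {d : ℕ} (F : EuclideanSpace ℝ (Fin d) → EuclideanSpace ℝ (Fin d))
    (ω θ : EuclideanSpace ℝ (Fin d)) (p : ℝ) : ℝ :=
  RadonT (fun x => ⟪θ, x⟫ * ⟪ω, F x⟫) ω p

/-- The weighted longitudinal Radon transform `[W_θ^∥F](ω,p)` with linear weight `⟪θ,x⟫`. -/
def Wlong {d : ℕ} (F : EuclideanSpace ℝ (Fin d) → EuclideanSpace ℝ (Fin d))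
    (ω θ : EuclideanSpace ℝ (Fin d)) (p : ℝ) : ℝ :=
  RadonT (fun x => ⟪θ, x⟫ * ⟪θ, F x⟫) ω p

/-- Smooth cutoff functions exhausting a finite-dimensional space. -/
theorem exists_cutoffs (V : Type*) [NormedAddCommGroup V] [InnerProductSpace ℝ V]
    [FiniteDimensional ℝ V] :
    ∃ (K : ℝ) (χ : ℕ → V → ℝ), 0 ≤ K ∧ (∀ n, ContDiff ℝ 1 (χ n)) ∧
      (∀ n, HasCompactSupport (χ n)) ∧ (∀ n y, |χ n y| ≤ 1) ∧
      (∀ n y, ‖fderiv ℝ (χ n) y‖ ≤ K / ((n : ℝ) + 1)) ∧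
      (∀ n y, ‖fderiv ℝ (χ n) y‖ ≤ 3 * K / (1 + ‖y‖)) ∧
      (∀ y, ∀ᶠ n in Filter.atTop, χ n y = 1) := by
  let f : ContDiffBump (0 : V) := ⟨1, 2, one_pos, one_lt_two⟩
  have hf : ContDiff ℝ 1 (f : V → ℝ) := f.contDiff
  have hfs : HasCompactSupport (f : V → ℝ) := f.hasCompactSupport
  obtain ⟨K, hK⟩ := (hfs.fderiv (𝕜 := ℝ)).exists_bound_of_continuous
    (hf.continuous_fderiv one_ne_zero)
  have hK0 : 0 ≤ K := (norm_nonneg _).trans (hK 0)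
  have hpos : ∀ n : ℕ, (0 : ℝ) < (n : ℝ) + 1 := fun n => by positivity
  have hder : ∀ (n : ℕ) (y : V), fderiv ℝ (fun y => f (((n : ℝ) + 1)⁻¹ • y)) y
      = ((n : ℝ) + 1)⁻¹ • fderiv ℝ f (((n : ℝ) + 1)⁻¹ • y) := fun n y => by
    rw [fderiv_comp_smul]
  have hb : ∀ (n : ℕ) (y : V), ‖fderiv ℝ (fun y => f (((n : ℝ) + 1)⁻¹ • y)) y‖
      ≤ K / ((n : ℝ) + 1) := fun n y => by
    rw [hder, norm_smul, norm_inv, Real.norm_of_nonneg (hpos n).le, inv_mul_eq_div]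
    exact div_le_div_of_nonneg_right (hK _) (hpos n).le
  refine ⟨K, fun n y => f (((n : ℝ) + 1)⁻¹ • y), hK0, fun n => ?_, fun n => ?_, fun n y => ?_,
    hb, fun n y => ?_, fun y => ?_⟩
  · exact hf.comp (contDiff_const_smul _)
  · exact hfs.comp_smul (inv_ne_zero (hpos n).ne')
  · rw [abs_of_nonneg f.nonneg]
    exact f.le_one
  · by_cases hy : 1 + ‖y‖ ≤ 3 * ((n : ℝ) + 1)
    · refine (hb n y).trans ?_
      rw [div_le_div_iff₀ (hpos n) (by positivity)]
      nlinarith [mul_le_mul_of_nonneg_left hy hK0]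
    · have hz : fderiv ℝ f (((n : ℝ) + 1)⁻¹ • y) = 0 := by
        apply image_eq_zero_of_notMem_tsupport
        intro h
        have h2 := tsupport_fderiv_subset ℝ h
        rw [f.tsupport_eq, mem_closedBall_zero_iff, norm_smul, norm_inv,
          Real.norm_of_nonneg (hpos n).le, inv_mul_le_iff₀ (hpos n)] at h2
        apply hy
        have h3 : ‖y‖ ≤ ((n : ℝ) + 1) * 2 := h2
        have : (0 : ℝ) ≤ n := n.cast_nonneg
        linarith
      rw [hder, hz, smul_zero, norm_zero]
      positivity
  · filter_upwards [Filter.eventually_ge_atTop ⌈‖y‖⌉₊] with n hn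
    apply f.one_of_mem_closedBall
    rw [mem_closedBall_zero_iff, norm_smul, norm_inv, Real.norm_of_nonneg (hpos n).le,
      inv_mul_le_iff₀ (hpos n)]
    have h1 := Nat.ceil_le.mp hn
    change ‖y‖ ≤ ((n : ℝ) + 1) * 1
    linarith

section IBP

variable {V : Type*} [NormedAddCommGroup V] [InnerProductSpace ℝ V] [FiniteDimensional ℝ V]
  [MeasurableSpace V] [BorelSpace V]

theorem cutoff_integrable_left {χ g : V → ℝ} (hχ : Continuous χ) (hs : HasCompactSupport χ)
    (hg : Continuous g) : Integrable (fun y => χ y * g y) :=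
  (hχ.mul hg).integrable_of_hasCompactSupport hs.mul_right

theorem cutoff_ibp {χ f : V → ℝ} (hχ : ContDiff ℝ 1 χ) (hs : HasCompactSupport χ)
    (hf : ContDiff ℝ 1 f) (v : V) :
    ∫ y, χ y * fderiv ℝ f y v = - ∫ y, fderiv ℝ χ y v * f y := by
  apply integral_mul_fderiv_eq_neg_fderiv_mul_of_integrable
  · refine cutoff_integrable_left ?_ (hs.fderiv_apply (𝕜 := ℝ) v) hf.continuous
    exact (hχ.continuous_fderiv one_ne_zero).clm_apply continuous_const
  · exact cutoff_integrable_left hχ.continuous hs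
      ((hf.continuous_fderiv one_ne_zero).clm_apply continuous_const)
  · exact cutoff_integrable_left hχ.continuous hs hf.continuous
  · exact fun x _ => hχ.differentiable one_ne_zero x
  · exact fun x _ => hf.differentiable one_ne_zero x

theorem integral_fderiv_eq_zero {f : V → ℝ} (hf : ContDiff ℝ 1 f) (v : V) {C r : ℝ}
    (hr : (Module.finrank ℝ V : ℝ) < r)
    (hfb : ∀ y, |f y| ≤ C * (1 + ‖y‖) ^ (1 - r))
    (hdb : ∀ y, |fderiv ℝ f y v| ≤ C * (1 + ‖y‖) ^ (-r)) :
    ∫ y, fderiv ℝ f y v = 0 := by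
  obtain ⟨K, χ, hK, hχ, hs, h1, hd1, hd2, hlim⟩ := exists_cutoffs V
  have hint : Integrable (fun y : V => (1 + ‖y‖) ^ (-r)) := integrable_one_add_norm hr
  have hc : Continuous fun y => fderiv ℝ f y v :=
    (hf.continuous_fderiv one_ne_zero).clm_apply continuous_const
  have hcχ : ∀ n, Continuous fun y => fderiv ℝ (χ n) y v := fun n =>
    ((hχ n).continuous_fderiv one_ne_zero).clm_apply continuous_const
  have A : Filter.Tendsto (fun n => ∫ y, χ n y * fderiv ℝ f y v) Filter.atTop
      (nhds (∫ y, fderiv ℝ f y v)) := by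
    refine tendsto_integral_of_dominated_convergence (fun y => C * (1 + ‖y‖) ^ (-r))
      (fun n => ((hχ n).continuous.mul hc).aestronglyMeasurable) (hint.const_mul C)
      (fun n => .of_forall fun y => ?_) (.of_forall fun y => ?_)
    · rw [norm_mul, Real.norm_eq_abs, Real.norm_eq_abs]
      exact (mul_le_of_le_one_left (abs_nonneg _) (h1 n y)).trans (hdb y)
    · refine tendsto_const_nhds.congr' ?_
      filter_upwards [hlim y] with n hn
      rw [hn, one_mul]
  have B : Filter.Tendsto (fun n => ∫ y, fderiv ℝ (χ n) y v * f y) Filter.atTop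
      (nhds (∫ _ : V, (0 : ℝ))) := by
    refine tendsto_integral_of_dominated_convergence
      (fun y => (3 * K * ‖v‖ * C) * (1 + ‖y‖) ^ (-r))
      (fun n => ((hcχ n).mul hf.continuous).aestronglyMeasurable) (hint.const_mul _)
      (fun n => .of_forall fun y => ?_) (.of_forall fun y => ?_)
    · have hp : 0 < 1 + ‖y‖ := by positivity
      rw [norm_mul, Real.norm_eq_abs (f y)]
      have e1 : ‖fderiv ℝ (χ n) y v‖ ≤ 3 * K / (1 + ‖y‖) * ‖v‖ :=
        (ContinuousLinearMap.le_opNorm _ _).trans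
          (mul_le_mul_of_nonneg_right (hd2 n y) (norm_nonneg _))
      refine (mul_le_mul e1 (hfb y) (abs_nonneg _) (by positivity)).trans (le_of_eq ?_)
      rw [sub_eq_add_neg, Real.rpow_add hp, Real.rpow_one]
      field_simp
    · have e : ∀ n : ℕ, ‖fderiv ℝ (χ n) y v * f y‖ ≤ (K * ‖v‖ * |f y|) * (1 / ((n : ℝ) + 1)) := by
        intro n
        rw [norm_mul, Real.norm_eq_abs (f y)]
        have e1 : ‖fderiv ℝ (χ n) y v‖ ≤ K / ((n : ℝ) + 1) * ‖v‖ :=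
          (ContinuousLinearMap.le_opNorm _ _).trans
            (mul_le_mul_of_nonneg_right (hd1 n y) (norm_nonneg _))
        refine (mul_le_mul_of_nonneg_right e1 (abs_nonneg _)).trans (le_of_eq ?_)
        ring
      refine squeeze_zero_norm e ?_
      simpa using tendsto_one_div_add_atTop_nhds_zero_nat.const_mul (K * ‖v‖ * |f y|)
  have E : (fun n => ∫ y, χ n y * fderiv ℝ f y v)
      = fun n => - ∫ y, fderiv ℝ (χ n) y v * f y :=
    funext fun n => cutoff_ibp (hχ n) (hs n) hf v
  rw [E] at A
  have := tendsto_nhds_unique A B.neg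
  simpa using this

end IBP

section Flux

variable {d : ℕ}

theorem vdiv_eq_sum_basis {S : EuclideanSpace ℝ (Fin d) → EuclideanSpace ℝ (Fin d)}
    (hS : ContDiff ℝ 1 S) (b : OrthonormalBasis (Fin d) ℝ (EuclideanSpace ℝ (Fin d)))
    (x : EuclideanSpace ℝ (Fin d)) :
    vdiv S x = ∑ j, ⟪b j, fderiv ℝ S x (b j)⟫ := by
  have h1 := LinearMap.trace_eq_sum_inner (fderiv ℝ S x).toLinearMap b
  have h2 := LinearMap.trace_eq_sum_inner (fderiv ℝ S x).toLinearMap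
    (EuclideanSpace.basisFun (Fin d) ℝ)
  simp only [ContinuousLinearMap.coe_coe] at h1 h2
  rw [← h1, h2]
  unfold vdiv
  refine Finset.sum_congr rfl fun j _ => ?_
  have : HasFDerivAt (fun y => ⟪canE d j, S y⟫)
      ((innerSL ℝ (canE d j)).comp (fderiv ℝ S x)) x :=
    (innerSL ℝ (canE d j)).hasFDerivAt.comp x
      (hS.differentiable one_ne_zero x).hasFDerivAt
  rw [this.fderiv]
  simp [canE]

theorem finrank_orth (b : OrthonormalBasis (Fin d) ℝ (EuclideanSpace ℝ (Fin d))) (i₀ : Fin d) :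
    (Module.finrank ℝ ((ℝ ∙ (b i₀))ᗮ : Submodule ℝ (EuclideanSpace ℝ (Fin d))) : ℝ) < d := by
  have h := (ℝ ∙ (b i₀)).finrank_add_finrank_orthogonal
  rw [finrank_span_singleton (b.orthonormal.ne_zero i₀), finrank_euclideanSpace,
    Fintype.card_fin] at h
  exact_mod_cast (by omega :
    Module.finrank ℝ ((ℝ ∙ (b i₀))ᗮ : Submodule ℝ (EuclideanSpace ℝ (Fin d))) < d)

theorem norm_sq_slice {ω : EuclideanSpace ℝ (Fin d)} (hω : ‖ω‖ = 1) (p : ℝ)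
    (y : ((ℝ ∙ ω)ᗮ : Submodule ℝ (EuclideanSpace ℝ (Fin d)))) :
    ‖p • ω + (y : EuclideanSpace ℝ (Fin d))‖ ^ 2 = p ^ 2 + ‖y‖ ^ 2 := by
  have h := Submodule.mem_orthogonal_singleton_iff_inner_right.mp y.2
  rw [norm_add_sq_real, inner_smul_left, h, norm_smul, hω]
  simp

theorem norm_slice_ge {ω : EuclideanSpace ℝ (Fin d)} (hω : ‖ω‖ = 1) (p : ℝ)
    (y : ((ℝ ∙ ω)ᗮ : Submodule ℝ (EuclideanSpace ℝ (Fin d)))) :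
    ‖y‖ ≤ ‖p • ω + (y : EuclideanSpace ℝ (Fin d))‖ := by
  have := norm_sq_slice hω p y
  exact le_of_sq_le_sq (by nlinarith [sq_nonneg p]) (norm_nonneg _)

theorem abs_slice_ge {ω : EuclideanSpace ℝ (Fin d)} (hω : ‖ω‖ = 1) (p : ℝ)
    (y : ((ℝ ∙ ω)ᗮ : Submodule ℝ (EuclideanSpace ℝ (Fin d)))) :
    |p| ≤ ‖p • ω + (y : EuclideanSpace ℝ (Fin d))‖ := by
  have := norm_sq_slice hω p y
  exact le_of_sq_le_sq (by nlinarith [sq_nonneg ‖y‖, sq_abs p]) (norm_nonneg _)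

theorem slice_bound {ω : EuclideanSpace ℝ (Fin d)} (hω : ‖ω‖ = 1) (p : ℝ) {C r : ℝ}
    (hC : 0 ≤ C) (hr : r ≤ 0)
    (y : ((ℝ ∙ ω)ᗮ : Submodule ℝ (EuclideanSpace ℝ (Fin d)))) :
    C * (1 + ‖p • ω + (y : EuclideanSpace ℝ (Fin d))‖) ^ r ≤ C * (1 + ‖y‖) ^ r := by
  refine mul_le_mul_of_nonneg_left ?_ hC
  exact Real.rpow_le_rpow_of_nonpos (by positivity)
    (by linarith [norm_slice_ge hω p y]) hr

theorem contDiff_slice (ω : EuclideanSpace ℝ (Fin d)) (p : ℝ) :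
    ContDiff ℝ 1 (fun y : ((ℝ ∙ ω)ᗮ : Submodule ℝ (EuclideanSpace ℝ (Fin d))) =>
      p • ω + (y : EuclideanSpace ℝ (Fin d))) :=
  contDiff_const.add ((ℝ ∙ ω)ᗮ).subtypeL.contDiff

theorem fderiv_slice {G : Type*} [NormedAddCommGroup G] [NormedSpace ℝ G]
    {f : EuclideanSpace ℝ (Fin d) → G} (hf : ContDiff ℝ 1 f)
    (ω : EuclideanSpace ℝ (Fin d)) (p : ℝ)
    (y v : ((ℝ ∙ ω)ᗮ : Submodule ℝ (EuclideanSpace ℝ (Fin d)))) :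
    fderiv ℝ (fun y : ((ℝ ∙ ω)ᗮ : Submodule ℝ (EuclideanSpace ℝ (Fin d))) =>
      f (p • ω + (y : EuclideanSpace ℝ (Fin d)))) y v
      = fderiv ℝ f (p • ω + (y : EuclideanSpace ℝ (Fin d))) v := by
  have h1 : HasFDerivAt (fun y : ((ℝ ∙ ω)ᗮ : Submodule ℝ (EuclideanSpace ℝ (Fin d))) =>
      p • ω + (y : EuclideanSpace ℝ (Fin d))) (Submodule.subtypeL _) y :=
    (Submodule.subtypeL _).hasFDerivAt.const_add _
  have h2 := (hf.differentiable one_ne_zero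
    (p • ω + (y : EuclideanSpace ℝ (Fin d)))).hasFDerivAt.comp y h1
  have h3 := h2.fderiv
  have h4 := congrArg (fun T => T v) h3
  exact h4

theorem fderiv_inner_const {S : EuclideanSpace ℝ (Fin d) → EuclideanSpace ℝ (Fin d)}
    (hS : ContDiff ℝ 1 S) (w x v : EuclideanSpace ℝ (Fin d)) :
    fderiv ℝ (fun y => ⟪w, S y⟫) x v = ⟪w, fderiv ℝ S x v⟫ := by
  have : HasFDerivAt (fun y => ⟪w, S y⟫)
      ((innerSL ℝ w).comp (fderiv ℝ S x)) x :=
    (innerSL ℝ w).hasFDerivAt.comp x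
      (hS.differentiable one_ne_zero x).hasFDerivAt
  rw [this.fderiv]
  simp

/-- Integral of the tangential derivative of a decaying potential vanishes. -/
theorem radon_grad_zero {φ : EuclideanSpace ℝ (Fin d) → ℝ} (hφ : ContDiff ℝ 1 φ)
    {C : ℝ} (hC : 0 ≤ C)
    (hd : 1 ≤ d)
    (hφb : ∀ x, |φ x| ≤ C * (1 + ‖x‖) ^ ((1 : ℝ) - d))
    (hgradb : ∀ x, ‖gradient φ x‖ ≤ C * (1 + ‖x‖) ^ (-(d : ℝ)))
    (b : OrthonormalBasis (Fin d) ℝ (EuclideanSpace ℝ (Fin d))) {i₀ j : Fin d} (hj : j ≠ i₀)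
    (p : ℝ) :
    ∫ y : ((ℝ ∙ (b i₀))ᗮ : Submodule ℝ (EuclideanSpace ℝ (Fin d))),
      ⟪b j, gradient φ (p • b i₀ + (y : EuclideanSpace ℝ (Fin d)))⟫ = 0 := by
  have hω : ‖b i₀‖ = 1 := b.orthonormal.1 i₀
  have hm : b j ∈ (ℝ ∙ (b i₀))ᗮ := Submodule.mem_orthogonal_singleton_iff_inner_right.mpr
    (b.orthonormal.2 hj.symm)
  have hd' : (1 : ℝ) ≤ d := by exact_mod_cast hd
  have key := integral_fderiv_eq_zero (hφ.comp (contDiff_slice (b i₀) p)) ⟨b j, hm⟩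
    (C := C) (finrank_orth b i₀)
    (fun y => (hφb _).trans (slice_bound hω p hC (by linarith) y))
    (fun y => by
      have := fderiv_slice hφ (b i₀) p y ⟨b j, hm⟩
      rw [Function.comp_def, this, ← inner_gradient_left]
      refine (abs_real_inner_le_norm _ _).trans ?_
      rw [b.orthonormal.1 j, mul_one]
      exact (hgradb _).trans (slice_bound hω p hC (by linarith) y))
  rw [← key]
  refine integral_congr_ae (.of_forall fun y => ?_)
  have := fderiv_slice hφ (b i₀) p y ⟨b j, hm⟩
  simp only [Function.comp_def]
  rw [this, ← inner_gradient_left, real_inner_comm]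

theorem slice_integrable {S : EuclideanSpace ℝ (Fin d) → EuclideanSpace ℝ (Fin d)}
    (hS : Continuous S) {C : ℝ} (hC : 0 ≤ C)
    (hSb : ∀ x, ‖S x‖ ≤ C * (1 + ‖x‖) ^ (-(d : ℝ)))
    (b : OrthonormalBasis (Fin d) ℝ (EuclideanSpace ℝ (Fin d))) (i₀ : Fin d) (p : ℝ) :
    Integrable fun y : ((ℝ ∙ (b i₀))ᗮ : Submodule ℝ (EuclideanSpace ℝ (Fin d))) =>
      S (p • b i₀ + (y : EuclideanSpace ℝ (Fin d))) := by
  refine ((integrable_one_add_norm (finrank_orth b i₀)).const_mul C).mono'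
    (hS.comp (contDiff_slice (b i₀) p).continuous).aestronglyMeasurable
    (.of_forall fun y => ?_)
  exact (hSb _).trans (slice_bound (b.orthonormal.1 i₀) p hC (by simp) y)

/-- Derivative of the truncated flux. -/
theorem cutoff_flux_hasDerivAt {S : EuclideanSpace ℝ (Fin d) → EuclideanSpace ℝ (Fin d)}
    (hS : ContDiff ℝ 1 S) (ω : EuclideanSpace ℝ (Fin d))
    {χ : ((ℝ ∙ ω)ᗮ : Submodule ℝ (EuclideanSpace ℝ (Fin d))) → ℝ}
    (hχ : Continuous χ) (hs : HasCompactSupport χ) (p : ℝ) :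
    HasDerivAt (fun q : ℝ => ∫ y, χ y * ⟪ω, S (q • ω + (y : EuclideanSpace ℝ (Fin d)))⟫)
      (∫ y, χ y * ⟪ω, fderiv ℝ S (p • ω + (y : EuclideanSpace ℝ (Fin d))) ω⟫) p := by
  have hcS : Continuous fun x => ⟪ω, fderiv ℝ S x ω⟫ :=
    continuous_const.inner ((hS.continuous_fderiv one_ne_zero).clm_apply continuous_const)
  have hcomp : IsCompact (Metric.closedBall p 1 ×ˢ tsupport χ) :=
    (isCompact_closedBall p 1).prod hs
  have hcont : Continuous fun z : ℝ × ((ℝ ∙ ω)ᗮ : Submodule ℝ (EuclideanSpace ℝ (Fin d))) =>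
      ⟪ω, fderiv ℝ S (z.1 • ω + (z.2 : EuclideanSpace ℝ (Fin d))) ω⟫ :=
    hcS.comp (by fun_prop)
  obtain ⟨M, hM⟩ := hcomp.exists_bound_of_continuousOn hcont.continuousOn
  refine (hasDerivAt_integral_of_dominated_loc_of_deriv_le
    (F := fun q y => χ y * ⟪ω, S (q • ω + (y : EuclideanSpace ℝ (Fin d)))⟫)
    (F' := fun q y => χ y * ⟪ω, fderiv ℝ S (q • ω + (y : EuclideanSpace ℝ (Fin d))) ω⟫)
    (bound := fun y => |χ y| * M) (Metric.closedBall_mem_nhds p one_pos)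
    (.of_forall fun q => ?_) ?_ ?_ (.of_forall fun y q hq => ?_) ?_
    (.of_forall fun y q hq => ?_)).2
  · exact (cutoff_integrable_left hχ hs (continuous_const.inner
      (hS.continuous.comp (contDiff_slice ω q).continuous))).aestronglyMeasurable
  · exact cutoff_integrable_left hχ hs (continuous_const.inner
      (hS.continuous.comp (contDiff_slice ω p).continuous))
  · exact (cutoff_integrable_left hχ hs
      (hcS.comp (contDiff_slice ω p).continuous)).aestronglyMeasurable
  · by_cases hy : y ∈ tsupport χ
    · rw [norm_mul, Real.norm_eq_abs (χ y)]
      exact mul_le_mul_of_nonneg_left (hM (q, y) ⟨hq, hy⟩) (abs_nonneg _)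
    · simp [image_eq_zero_of_notMem_tsupport hy]
  · exact ((hχ.integrable_of_hasCompactSupport hs).abs).mul_const M
  · refine HasDerivAt.const_mul _ ?_
    have h1 : HasDerivAt (fun q : ℝ => q • ω + (y : EuclideanSpace ℝ (Fin d))) ω q := by
      simpa using ((hasDerivAt_id q).smul_const ω).add_const (y : EuclideanSpace ℝ (Fin d))
    have h2 := (hS.differentiable one_ne_zero
      (q • ω + (y : EuclideanSpace ℝ (Fin d)))).hasFDerivAt.comp_hasDerivAt q h1
    exact (innerSL ℝ ω).hasFDerivAt.comp_hasDerivAt q h2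

theorem cutoff_flux_deriv_bound {S : EuclideanSpace ℝ (Fin d) → EuclideanSpace ℝ (Fin d)}
    (hS : ContDiff ℝ 1 S) (hsol : ∀ x, vdiv S x = 0) {C : ℝ} (hC : 0 ≤ C)
    (hSb : ∀ x, ‖S x‖ ≤ C * (1 + ‖x‖) ^ (-(d : ℝ)))
    (b : OrthonormalBasis (Fin d) ℝ (EuclideanSpace ℝ (Fin d))) (i₀ : Fin d)
    {χ : ((ℝ ∙ (b i₀))ᗮ : Submodule ℝ (EuclideanSpace ℝ (Fin d))) → ℝ}
    (hχ : ContDiff ℝ 1 χ) (hs : HasCompactSupport χ) {κ : ℝ} (hκ : ∀ y, ‖fderiv ℝ χ y‖ ≤ κ)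
    (p : ℝ) :
    ‖∫ y, χ y * ⟪b i₀, fderiv ℝ S (p • b i₀ + (y : EuclideanSpace ℝ (Fin d))) (b i₀)⟫‖
      ≤ d * (κ * ∫ y : ((ℝ ∙ (b i₀))ᗮ : Submodule ℝ (EuclideanSpace ℝ (Fin d))),
        C * (1 + ‖y‖) ^ (-(d : ℝ))) := by
  have hω : ‖b i₀‖ = 1 := b.orthonormal.1 i₀
  have hκ0 : 0 ≤ κ := (norm_nonneg (fderiv ℝ χ 0)).trans (hκ 0)
  have hI0 : 0 ≤ ∫ y : ((ℝ ∙ (b i₀))ᗮ : Submodule ℝ (EuclideanSpace ℝ (Fin d))),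
        C * (1 + ‖y‖) ^ (-(d : ℝ)) := integral_nonneg fun y => by positivity
  have hpt : ∀ y : ((ℝ ∙ (b i₀))ᗮ : Submodule ℝ (EuclideanSpace ℝ (Fin d))),
      χ y * ⟪b i₀, fderiv ℝ S (p • b i₀ + (y : EuclideanSpace ℝ (Fin d))) (b i₀)⟫
      = - ∑ j ∈ Finset.univ.erase i₀,
        χ y * ⟪b j, fderiv ℝ S (p • b i₀ + (y : EuclideanSpace ℝ (Fin d))) (b j)⟫ := by
    intro y
    have h := hsol (p • b i₀ + (y : EuclideanSpace ℝ (Fin d)))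
    rw [vdiv_eq_sum_basis hS b, ← Finset.add_sum_erase _ _ (Finset.mem_univ i₀)] at h
    rw [← Finset.mul_sum, eq_neg_of_add_eq_zero_left h, mul_neg]
  have hcS : ∀ j, Continuous fun x => ⟪b j, fderiv ℝ S x (b j)⟫ := fun j =>
    continuous_const.inner ((hS.continuous_fderiv one_ne_zero).clm_apply continuous_const)
  have hints : ∀ j ∈ Finset.univ.erase i₀, Integrable fun y =>
      χ y * ⟪b j, fderiv ℝ S (p • b i₀ + (y : EuclideanSpace ℝ (Fin d))) (b j)⟫ :=
    fun j _ => cutoff_integrable_left hχ.continuous hs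
      ((hcS j).comp (contDiff_slice (b i₀) p).continuous)
  rw [integral_congr_ae (.of_forall hpt), integral_neg, norm_neg, integral_finsetSum _ hints]
  have hterm : ∀ j ∈ Finset.univ.erase i₀,
      ‖∫ y, χ y * ⟪b j, fderiv ℝ S (p • b i₀ + (y : EuclideanSpace ℝ (Fin d))) (b j)⟫‖
      ≤ κ * ∫ y : ((ℝ ∙ (b i₀))ᗮ : Submodule ℝ (EuclideanSpace ℝ (Fin d))),
        C * (1 + ‖y‖) ^ (-(d : ℝ)) := by
    intro j hj
    have hj' : j ≠ i₀ := Finset.ne_of_mem_erase hj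
    have hm : b j ∈ (ℝ ∙ (b i₀))ᗮ := Submodule.mem_orthogonal_singleton_iff_inner_right.mpr
      (b.orthonormal.2 hj'.symm)
    have hSj : ContDiff ℝ 1 fun x => ⟪b j, S x⟫ := contDiff_const.inner ℝ hS
    have e := cutoff_ibp hχ hs (hSj.comp (contDiff_slice (b i₀) p)) ⟨b j, hm⟩
    have e2 : ∀ y, fderiv ℝ ((fun x => ⟪b j, S x⟫) ∘ fun y :
        ((ℝ ∙ (b i₀))ᗮ : Submodule ℝ (EuclideanSpace ℝ (Fin d))) =>
        p • b i₀ + (y : EuclideanSpace ℝ (Fin d))) y ⟨b j, hm⟩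
        = ⟪b j, fderiv ℝ S (p • b i₀ + (y : EuclideanSpace ℝ (Fin d))) (b j)⟫ := fun y => by
      rw [← fderiv_inner_const hS]
      exact fderiv_slice hSj (b i₀) p y ⟨b j, hm⟩
    simp only [e2] at e
    rw [e, norm_neg, ← integral_const_mul]
    refine norm_integral_le_of_norm_le
      (((integrable_one_add_norm (finrank_orth b i₀)).const_mul C).const_mul κ)
      (.of_forall fun y => ?_)
    rw [norm_mul]
    refine mul_le_mul ?_ ?_ (norm_nonneg _) hκ0
    · refine (ContinuousLinearMap.le_opNorm _ _).trans ?_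
      have : ‖(⟨b j, hm⟩ : ((ℝ ∙ (b i₀))ᗮ : Submodule ℝ (EuclideanSpace ℝ (Fin d))))‖ = 1 :=
        b.orthonormal.1 j
      rw [this, mul_one]
      exact hκ y
    · refine (norm_inner_le_norm _ _).trans ?_
      rw [b.orthonormal.1 j, one_mul]
      exact (hSb _).trans (slice_bound hω p hC (by simp) y)
  refine (norm_sum_le_of_le _ hterm).trans ?_
  rw [Finset.sum_const, nsmul_eq_mul]
  refine mul_le_mul_of_nonneg_right ?_ (mul_nonneg hκ0 hI0)
  exact_mod_cast (Finset.card_le_univ _).trans (by simp)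

theorem flux_const {S : EuclideanSpace ℝ (Fin d) → EuclideanSpace ℝ (Fin d)}
    (hS : ContDiff ℝ 1 S) (hsol : ∀ x, vdiv S x = 0) {C : ℝ} (hC : 0 ≤ C)
    (hSb : ∀ x, ‖S x‖ ≤ C * (1 + ‖x‖) ^ (-(d : ℝ)))
    (b : OrthonormalBasis (Fin d) ℝ (EuclideanSpace ℝ (Fin d))) (i₀ : Fin d) (p q : ℝ) :
    ∫ y : ((ℝ ∙ (b i₀))ᗮ : Submodule ℝ (EuclideanSpace ℝ (Fin d))),
      ⟪b i₀, S (p • b i₀ + (y : EuclideanSpace ℝ (Fin d)))⟫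
    = ∫ y : ((ℝ ∙ (b i₀))ᗮ : Submodule ℝ (EuclideanSpace ℝ (Fin d))),
      ⟪b i₀, S (q • b i₀ + (y : EuclideanSpace ℝ (Fin d)))⟫ := by
  obtain ⟨K, χ, hK, hχ, hs, h1, hd1, -, hlim⟩ :=
    exists_cutoffs ((ℝ ∙ (b i₀))ᗮ : Submodule ℝ (EuclideanSpace ℝ (Fin d)))
  have A : ∀ p : ℝ, Filter.Tendsto (fun n => ∫ y, χ n y *
      ⟪b i₀, S (p • b i₀ + (y : EuclideanSpace ℝ (Fin d)))⟫) Filter.atTop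
      (nhds (∫ y : ((ℝ ∙ (b i₀))ᗮ : Submodule ℝ (EuclideanSpace ℝ (Fin d))),
        ⟪b i₀, S (p • b i₀ + (y : EuclideanSpace ℝ (Fin d)))⟫)) := by
    intro p
    have hint := (slice_integrable hS.continuous hC hSb b i₀ p).const_inner (𝕜 := ℝ) (b i₀)
    refine tendsto_integral_of_dominated_convergence _
      (fun n => (hχ n).continuous.aestronglyMeasurable.mul hint.aestronglyMeasurable) hint.norm
      (fun n => .of_forall fun y => ?_) (.of_forall fun y => ?_)
    · rw [norm_mul]
      exact mul_le_of_le_one_left (norm_nonneg _) (h1 n y)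
    · refine tendsto_const_nhds.congr' ?_
      filter_upwards [hlim y] with n hn
      rw [hn, one_mul]
  set I := ∫ y : ((ℝ ∙ (b i₀))ᗮ : Submodule ℝ (EuclideanSpace ℝ (Fin d))),
        C * (1 + ‖y‖) ^ (-(d : ℝ))
  have B : Filter.Tendsto (fun n => (∫ y, χ n y *
      ⟪b i₀, S (p • b i₀ + (y : EuclideanSpace ℝ (Fin d)))⟫) - ∫ y, χ n y *
      ⟪b i₀, S (q • b i₀ + (y : EuclideanSpace ℝ (Fin d)))⟫) Filter.atTop (nhds 0) := by
    have e : ∀ n : ℕ, ‖(∫ y, χ n y *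
      ⟪b i₀, S (p • b i₀ + (y : EuclideanSpace ℝ (Fin d)))⟫) - ∫ y, χ n y *
      ⟪b i₀, S (q • b i₀ + (y : EuclideanSpace ℝ (Fin d)))⟫‖
      ≤ (d * K * I * ‖p - q‖) * (1 / ((n : ℝ) + 1)) := by
      intro n
      have := Convex.norm_image_sub_le_of_norm_hasDerivWithin_le (𝕜 := ℝ)
        (fun x _ => (cutoff_flux_hasDerivAt hS (b i₀) (hχ n).continuous (hs n)
          x).hasDerivWithinAt)
        (fun x _ => cutoff_flux_deriv_bound hS hsol hC hSb b i₀ (hχ n) (hs n) (hd1 n) x)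
        convex_univ (Set.mem_univ q) (Set.mem_univ p)
      refine this.trans (le_of_eq ?_)
      ring
    refine squeeze_zero_norm e ?_
    simpa using tendsto_one_div_add_atTop_nhds_zero_nat.const_mul (d * K * I * ‖p - q‖)
  exact sub_eq_zero.mp (tendsto_nhds_unique ((A p).sub (A q)) B)

theorem flux_zero {S : EuclideanSpace ℝ (Fin d) → EuclideanSpace ℝ (Fin d)}
    (hd : 1 ≤ d)
    (hS : ContDiff ℝ 1 S) (hsol : ∀ x, vdiv S x = 0) {C : ℝ} (hC : 0 ≤ C)
    (hSb : ∀ x, ‖S x‖ ≤ C * (1 + ‖x‖) ^ (-(d : ℝ)))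
    (b : OrthonormalBasis (Fin d) ℝ (EuclideanSpace ℝ (Fin d))) (i₀ : Fin d) (p : ℝ) :
    ∫ y : ((ℝ ∙ (b i₀))ᗮ : Submodule ℝ (EuclideanSpace ℝ (Fin d))),
      ⟪b i₀, S (p • b i₀ + (y : EuclideanSpace ℝ (Fin d)))⟫ = 0 := by
  have hω : ‖b i₀‖ = 1 := b.orthonormal.1 i₀
  have hle : ∀ x, ‖⟪b i₀, S x⟫‖ ≤ C * (1 + ‖x‖) ^ (-(d : ℝ)) := fun x => by
    refine (norm_inner_le_norm _ _).trans ?_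
    rw [hω, one_mul]
    exact hSb x
  have A : Filter.Tendsto (fun n : ℕ =>
      ∫ y : ((ℝ ∙ (b i₀))ᗮ : Submodule ℝ (EuclideanSpace ℝ (Fin d))),
      ⟪b i₀, S ((n : ℝ) • b i₀ + (y : EuclideanSpace ℝ (Fin d)))⟫) Filter.atTop
      (nhds (∫ _ : ((ℝ ∙ (b i₀))ᗮ : Submodule ℝ (EuclideanSpace ℝ (Fin d))), (0 : ℝ))) := by
    refine tendsto_integral_of_dominated_convergence _
      (fun n => ((slice_integrable hS.continuous hC hSb b i₀ n).const_inner (𝕜 := ℝ)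
        (b i₀)).aestronglyMeasurable)
      ((integrable_one_add_norm (finrank_orth b i₀)).const_mul C)
      (fun n => .of_forall fun y => ?_) (.of_forall fun y => ?_)
    · exact (hle _).trans (slice_bound hω n hC (by simp) y)
    · have e : ∀ n : ℕ, ‖⟪b i₀, S ((n : ℝ) • b i₀ + (y : EuclideanSpace ℝ (Fin d)))⟫‖
          ≤ C * (1 + (n : ℝ)) ^ (-(d : ℝ)) := fun n => by
        refine (hle _).trans (mul_le_mul_of_nonneg_left ?_ hC)
        refine Real.rpow_le_rpow_of_nonpos (by positivity) ?_ (by simp)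
        have := abs_slice_ge hω n y
        rw [abs_of_nonneg n.cast_nonneg] at this
        linarith
      refine squeeze_zero_norm e ?_
      have h0 : (0 : ℝ) < d := by exact_mod_cast hd
      have h2 : Filter.Tendsto (fun n : ℕ => 1 + (n : ℝ)) Filter.atTop Filter.atTop :=
        Filter.tendsto_atTop_add_const_left _ _ tendsto_natCast_atTop_atTop
      simpa using ((tendsto_rpow_neg_atTop h0).comp h2).const_mul C
  have E : (fun n : ℕ =>
      ∫ y : ((ℝ ∙ (b i₀))ᗮ : Submodule ℝ (EuclideanSpace ℝ (Fin d))),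
      ⟪b i₀, S ((n : ℝ) • b i₀ + (y : EuclideanSpace ℝ (Fin d)))⟫) = fun _ =>
      ∫ y : ((ℝ ∙ (b i₀))ᗮ : Submodule ℝ (EuclideanSpace ℝ (Fin d))),
      ⟪b i₀, S (p • b i₀ + (y : EuclideanSpace ℝ (Fin d)))⟫ :=
    funext fun n => flux_const hS hsol hC hSb b i₀ n p
  rw [E] at A
  simpa using tendsto_nhds_unique tendsto_const_nhds A

end Flux

/-- for `F = ∇φ + S` with `S` solenoidal, the componentwise Radon transform of
the solenoidal part `S` is recovered from the longitudinal transforms of `F`: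
`[𝕽S](ω,p) = Σ_{j≠i₀} [D_{ω_j}^∥F](ω,p) • ω_j` for every orthonormal basis
`(ω, ω_1, …, ω_{d−1}) = (b i₀, (b j)_{j≠i₀})`. -/
theorem stmt9 (d : ℕ) (hd : 2 ≤ d)
    (φ : EuclideanSpace ℝ (Fin d) → ℝ) (hregφ : ContDiff ℝ 1 φ)
    (S : EuclideanSpace ℝ (Fin d) → EuclideanSpace ℝ (Fin d)) (hregS : ContDiff ℝ 1 S)
    (hsol : ∀ x, vdiv S x = 0)
    (C : ℝ) (hC : 0 ≤ C)
    (hφb : ∀ x, |φ x| ≤ C * (1 + ‖x‖) ^ ((1 : ℝ) - d))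
    (hgradb : ∀ x, ‖gradient φ x‖ ≤ C * (1 + ‖x‖) ^ (-(d : ℝ)))
    (hSb : ∀ x, ‖S x‖ ≤ C * (1 + ‖x‖) ^ (-(d : ℝ)))
    (F : EuclideanSpace ℝ (Fin d) → EuclideanSpace ℝ (Fin d))
    (hF : ∀ x, F x = gradient φ x + S x)
    (b : OrthonormalBasis (Fin d) ℝ (EuclideanSpace ℝ (Fin d))) (i₀ : Fin d) (p : ℝ) :
    RadonVec S (b i₀) p =
      ∑ j ∈ Finset.univ.erase i₀, (Dlong F (b i₀) (b j) p) • b j := by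
  have hd1 : 1 ≤ d := by omega
  have hSint := slice_integrable hregS.continuous hC hSb b i₀ p
  have hgc : Continuous (gradient φ) :=
    (InnerProductSpace.toDual ℝ (EuclideanSpace ℝ (Fin d))).symm.continuous.comp
      (hregφ.continuous_fderiv one_ne_zero)
  have hgint := slice_integrable hgc hC hgradb b i₀ p
  rw [← b.sum_repr' (RadonVec S (b i₀) p), ← Finset.add_sum_erase _ _ (Finset.mem_univ i₀)]
  have h0 : ⟪b i₀, RadonVec S (b i₀) p⟫ = 0 := by
    unfold RadonVec
    rw [← integral_inner hSint]
    exact flux_zero hd1 hregS hsol hC hSb b i₀ p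
  rw [h0, zero_smul, zero_add]
  refine Finset.sum_congr rfl fun j hj => ?_
  congr 1
  unfold RadonVec Dlong RadonT
  simp only [hF, inner_add_right]
  rw [integral_add (hgint.const_inner (𝕜 := ℝ) (b j)) (hSint.const_inner (𝕜 := ℝ) (b j)),
    radon_grad_zero hregφ hC hd1 hφb hgradb b (Finset.ne_of_mem_erase hj) p, zero_add,
    integral_inner hSint]
end
end

section
/- Let d ≥ 2 and let F : EuclideanSpace ℝ (Fin d) → EuclideanSpace ℝ (Fin d) be a vector field each of whose components is a Schwartz function. Let Φ = div F and define Ψ : ℝ^d → ℝ^d componentwise by ⟪e_j, Ψ(x)⟫ = Δ(F_j)(x) − ∂Φ/∂x_j(x), where F_j(x) = ⟪e_j, F(x)⟫ (so Ψ is the componentwise Laplacian of the solenoidal part of F). Then for every orthonormal basis (ω, ω_1, …, ω_{d−1}) of ℝ^d and every p ∈ ℝ, the vector-valued function p' ↦ Σ_{j=1}^{d−1} [D_{ω_j}^∥F](ω,p') • ω_j is twice differentiable in p', and its second derivative at p equals the componentwise Radon transform [𝕽Ψ](ω,p) = ∫_{y ∈ (ℝ∙ω)ᗮ} Ψ(p•ω+y)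 dy. -/
open MeasureTheory Real
open scoped RealInnerProductSpace

noncomputable section

open LineDeriv in
/-- Directional derivative of a scalar Schwartz function. -/
def sD {d : ℕ} (v : EuclideanSpace ℝ (Fin d)) (f : SchwartzMap (EuclideanSpace ℝ (Fin d)) ℝ) :
    SchwartzMap (EuclideanSpace ℝ (Fin d)) ℝ := ∂_{v} f

lemma aux_fderiv {d : ℕ} (f : SchwartzMap (EuclideanSpace ℝ (Fin d)) ℝ)
    (v x : EuclideanSpace ℝ (Fin d)) : fderiv ℝ f x v = (sD v f) x :=
  (SchwartzMap.lineDerivOp_apply_eq_fderiv v f x).symm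

lemma aux_comm {d : ℕ} (f : SchwartzMap (EuclideanSpace ℝ (Fin d)) ℝ)
    (v w : EuclideanSpace ℝ (Fin d)) : sD v (sD w f) = sD w (sD v f) := by
  have key : ∀ a b x : EuclideanSpace ℝ (Fin d),
      (sD a (sD b f)) x = fderiv ℝ (fderiv ℝ f) x a b := by
    intro a b x
    rw [← aux_fderiv]
    have h : (⇑(sD b f)) = fun y => fderiv ℝ f y b := by
      ext y; exact (aux_fderiv f b y).symm
    rw [h]
    have hd : DifferentiableAt ℝ (fderiv ℝ f) x :=
      ((f.smooth 2).fderiv_right (m := 1) (by norm_num)).differentiable (by norm_num) x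
    rw [fderiv_clm_apply hd (by fun_prop)]
    simp
  ext x
  rw [key, key]
  have hs : IsSymmSndFDerivAt ℝ f x :=
    (f.smooth 2).contDiffAt.isSymmSndFDerivAt (by simp)
  exact hs v w

lemma aux_bound {d : ℕ} (f : SchwartzMap (EuclideanSpace ℝ (Fin d)) ℝ) (k : ℕ) :
    ∃ C : ℝ, 0 ≤ C ∧ ∀ x, ‖f x‖ ≤ C * (1 + ‖x‖) ^ (-(k : ℝ)) := by
  refine ⟨2 ^ k * (Finset.Iic (k, 0)).sup (fun m => SchwartzMap.seminorm ℝ m.1 m.2) f,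
    by positivity, fun x => ?_⟩
  have h := SchwartzMap.one_add_le_sup_seminorm_apply (𝕜 := ℝ) (m := (k, 0)) (le_refl k)
    (le_refl 0) f x
  rw [norm_iteratedFDeriv_zero] at h
  have hp : (0 : ℝ) < (1 + ‖x‖) ^ k := by positivity
  rw [Real.rpow_neg (by positivity), Real.rpow_natCast, ← div_eq_mul_inv, le_div_iff₀ hp]
  linarith

lemma aux_norm {d : ℕ} (ω : EuclideanSpace ℝ (Fin d)) (p : ℝ)
    (y : ((ℝ ∙ ω)ᗮ : Submodule ℝ (EuclideanSpace ℝ (Fin d)))) :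
    ‖y‖ ≤ ‖p • ω + (y : EuclideanSpace ℝ (Fin d))‖ := by
  have h0 : ⟪p • ω, (y : EuclideanSpace ℝ (Fin d))⟫ = 0 := by
    rw [inner_smul_left, Submodule.mem_orthogonal_singleton_iff_inner_right.1 y.2, mul_zero]
  have h := norm_add_sq_real (p • ω) (y : EuclideanSpace ℝ (Fin d))
  rw [h0] at h
  change ‖(y : EuclideanSpace ℝ (Fin d))‖ ≤ _
  refine (sq_le_sq₀ (norm_nonneg _) (norm_nonneg _)).1 ?_
  nlinarith [sq_nonneg ‖p • ω‖]

lemma aux_bound' {d : ℕ} (f : SchwartzMap (EuclideanSpace ℝ (Fin d)) ℝ)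
    (ω : EuclideanSpace ℝ (Fin d)) :
    ∃ B : ((ℝ ∙ ω)ᗮ : Submodule ℝ (EuclideanSpace ℝ (Fin d))) → ℝ, Integrable B ∧
      ∀ (p : ℝ) (y : ((ℝ ∙ ω)ᗮ : Submodule ℝ (EuclideanSpace ℝ (Fin d)))),
        ‖f (p • ω + (y : EuclideanSpace ℝ (Fin d)))‖ ≤ B y := by
  set W := ((ℝ ∙ ω)ᗮ : Submodule ℝ (EuclideanSpace ℝ (Fin d)))
  obtain ⟨C, hC0, hC⟩ := aux_bound f (Module.finrank ℝ W + 1)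
  refine ⟨fun y => C * (1 + ‖y‖) ^ (-((Module.finrank ℝ W + 1 : ℕ) : ℝ)), ?_, fun p y => ?_⟩
  · apply Integrable.const_mul
    apply integrable_one_add_norm
    push_cast; linarith
  · refine (hC _).trans ?_
    have := aux_norm ω p y
    apply mul_le_mul_of_nonneg_left _ hC0
    apply Real.rpow_le_rpow_of_nonpos (by positivity) (by linarith)
    have : (0 : ℝ) ≤ ((Module.finrank ℝ W + 1 : ℕ) : ℝ) := by positivity
    linarith

lemma aux_int {d : ℕ} (f : SchwartzMap (EuclideanSpace ℝ (Fin d)) ℝ)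
    (ω : EuclideanSpace ℝ (Fin d)) (p : ℝ) :
    Integrable (fun y : ((ℝ ∙ ω)ᗮ : Submodule ℝ (EuclideanSpace ℝ (Fin d))) =>
      f (p • ω + (y : EuclideanSpace ℝ (Fin d)))) := by
  obtain ⟨B, hB, h⟩ := aux_bound' f ω
  refine hB.mono' ?_ (Filter.Eventually.of_forall fun y => h p y)
  apply Continuous.aestronglyMeasurable
  exact f.continuous.comp (by fun_prop)

lemma aux_deriv {d : ℕ} (f : SchwartzMap (EuclideanSpace ℝ (Fin d)) ℝ)
    (ω : EuclideanSpace ℝ (Fin d)) (p : ℝ) :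
    HasDerivAt (RadonT f ω) (RadonT (sD ω f) ω p) p := by
  obtain ⟨B, hB, h⟩ := aux_bound' (sD ω f) ω
  refine (hasDerivAt_integral_of_dominated_loc_of_deriv_le (bound := B)
    (F := fun (p : ℝ) (y : ((ℝ ∙ ω)ᗮ : Submodule ℝ (EuclideanSpace ℝ (Fin d)))) =>
      f (p • ω + (y : EuclideanSpace ℝ (Fin d))))
    (F' := fun (p : ℝ) (y : ((ℝ ∙ ω)ᗮ : Submodule ℝ (EuclideanSpace ℝ (Fin d)))) =>
      (sD ω f) (p • ω + (y : EuclideanSpace ℝ (Fin d))))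
    Filter.univ_mem (Filter.Eventually.of_forall fun q => (aux_int f ω q).aestronglyMeasurable)
    (aux_int f ω p) (aux_int _ ω p).aestronglyMeasurable
    (Filter.Eventually.of_forall fun y q _ => h q y) hB
    (Filter.Eventually.of_forall fun y q _ => ?_)).2
  rw [← aux_fderiv]
  have h1 : HasDerivAt (fun q : ℝ => q • ω + (y : EuclideanSpace ℝ (Fin d))) ω q := by
    simpa using ((hasDerivAt_id q).smul_const ω).add_const (y : EuclideanSpace ℝ (Fin d))
  exact (f.hasFDerivAt _).comp_hasDerivAt q h1

lemma aux_zero {d : ℕ} (f : SchwartzMap (EuclideanSpace ℝ (Fin d)) ℝ)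
    (ω θ : EuclideanSpace ℝ (Fin d)) (hθ : ⟪ω, θ⟫ = 0) (p : ℝ) :
    RadonT (sD θ f) ω p = 0 := by
  set W := ((ℝ ∙ ω)ᗮ : Submodule ℝ (EuclideanSpace ℝ (Fin d))) with hW
  let t : W := ⟨θ, Submodule.mem_orthogonal_singleton_iff_inner_right.2 hθ⟩
  let u : W → ℝ := fun y => f (p • ω + (y : EuclideanSpace ℝ (Fin d)))
  have hd : ∀ y : W, HasFDerivAt u ((fderiv ℝ f (p • ω + (y : EuclideanSpace ℝ (Fin d)))).comp
      W.subtypeL) y := by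
    intro y
    have h1 : HasFDerivAt (fun y : W => p • ω + (y : EuclideanSpace ℝ (Fin d))) W.subtypeL y :=
      W.subtypeL.hasFDerivAt.const_add _
    exact (f.hasFDerivAt _).comp y h1
  have hd' : ∀ y : W, fderiv ℝ u y t = (sD θ f) (p • ω + (y : EuclideanSpace ℝ (Fin d))) := by
    intro y
    rw [(hd y).fderiv, ← aux_fderiv]; rfl
  have := integral_mul_fderiv_eq_neg_fderiv_mul_of_integrable (μ := (volume : Measure W))
    (𝕜 := ℝ) (f := fun _ : W => (1 : ℝ)) (g := u) (v := t)
    (by simp) (by simpa [hd'] using aux_int (sD θ f) ω p) (by simpa using aux_int f ω p)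
    (by simp) (fun y _ => (hd y).differentiableAt)
  simpa [hd', RadonT] using this


lemma sD_sum {d : ℕ} {ι : Type*} (s : Finset ι) (v : EuclideanSpace ℝ (Fin d))
    (f : ι → SchwartzMap (EuclideanSpace ℝ (Fin d)) ℝ) :
    sD v (∑ i ∈ s, f i) = ∑ i ∈ s, sD v (f i) := LineDeriv.lineDerivOp_sum _ _ _

lemma sD_smul {d : ℕ} (c : ℝ) (v : EuclideanSpace ℝ (Fin d))
    (f : SchwartzMap (EuclideanSpace ℝ (Fin d)) ℝ) :
    sD v (c • f) = c • sD v f := LineDeriv.lineDerivOp_smul _ _ _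

lemma sD_left_sum {d : ℕ} {ι : Type*} (s : Finset ι) (v : ι → EuclideanSpace ℝ (Fin d))
    (f : SchwartzMap (EuclideanSpace ℝ (Fin d)) ℝ) :
    sD (∑ i ∈ s, v i) f = ∑ i ∈ s, sD (v i) f := LineDeriv.lineDerivOp_left_sum _ _ _

lemma sD_left_smul {d : ℕ} (c : ℝ) (v : EuclideanSpace ℝ (Fin d))
    (f : SchwartzMap (EuclideanSpace ℝ (Fin d)) ℝ) :
    sD (c • v) f = c • sD v f := LineDeriv.lineDerivOp_left_smul _ _ _

lemma sD_lap {d : ℕ} (b b' : OrthonormalBasis (Fin d) ℝ (EuclideanSpace ℝ (Fin d)))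
    (f : SchwartzMap (EuclideanSpace ℝ (Fin d)) ℝ) :
    ∑ j, sD (b j) (sD (b j) f) = ∑ j, sD (b' j) (sD (b' j) f) :=
  (SchwartzMap.laplacian_eq_sum b f).symm.trans (SchwartzMap.laplacian_eq_sum b' f)

/-- The Radon transform as a linear functional on Schwartz functions. -/
def RL {d : ℕ} (ω : EuclideanSpace ℝ (Fin d)) (p : ℝ) :
    SchwartzMap (EuclideanSpace ℝ (Fin d)) ℝ →ₗ[ℝ] ℝ where
  toFun f := RadonT f ω p
  map_add' f g := by
    simp only [RadonT, SchwartzMap.add_apply]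
    exact integral_add (aux_int f ω p) (aux_int g ω p)
  map_smul' c f := by
    simp only [RadonT, SchwartzMap.smul_apply, smul_eq_mul, RingHom.id_apply]
    exact integral_const_mul _ _

/-- the vector-valued function `p' ↦ Σ_{j≠i₀} [D_{ω_j}^∥F](ω,p') • ω_j` is
twice differentiable and its second derivative at `p` equals the componentwise Radon
transform of `Ψ`, the componentwise Laplacian of the solenoidal part of `F`. -/
theorem stmt10 (d : ℕ) (hd : 2 ≤ d)
    (F : EuclideanSpace ℝ (Fin d) → EuclideanSpace ℝ (Fin d))
    (hF : ∀ j : Fin d, IsSchwartz (fun x => ⟪canE d j, F x⟫))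
    (Φ : EuclideanSpace ℝ (Fin d) → ℝ) (hΦ : ∀ x, Φ x = vdiv F x)
    (Ψ : EuclideanSpace ℝ (Fin d) → EuclideanSpace ℝ (Fin d))
    (hΨ : ∀ (j : Fin d) x,
      ⟪canE d j, Ψ x⟫ = lap (fun y => ⟪canE d j, F y⟫) x - fderiv ℝ Φ x (canE d j))
    (b : OrthonormalBasis (Fin d) ℝ (EuclideanSpace ℝ (Fin d))) (i₀ : Fin d) (p : ℝ)
    (g : ℝ → EuclideanSpace ℝ (Fin d))
    (hg : ∀ p', g p' = ∑ j ∈ Finset.univ.erase i₀, (Dlong F (b i₀) (b j) p') • b j) :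
    (∀ q, DifferentiableAt ℝ g q) ∧ (∀ q, DifferentiableAt ℝ (deriv g) q) ∧
      deriv (deriv g) p = RadonVec Ψ (b i₀) p := by
  classical
  choose f hf using hF
  set e := EuclideanSpace.basisFun (Fin d) ℝ with he
  have hec : ∀ k, canE d k = e k := fun k => by simp [canE, he]
  simp only [hec] at hf hΨ
  set S : EuclideanSpace ℝ (Fin d) → SchwartzMap (EuclideanSpace ℝ (Fin d)) ℝ :=
    fun v => ∑ k, ⟪e k, v⟫ • f k with hSdef
  have hS : ∀ v x, S v x = ⟪v, F x⟫ := by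
    intro v x
    rw [← e.sum_inner_mul_inner v (F x)]
    simp [hSdef, SchwartzMap.sum_apply, hf, real_inner_comm]
  set P : SchwartzMap (EuclideanSpace ℝ (Fin d)) ℝ := ∑ j, sD (e j) (f j) with hP
  have hPΦ : Φ = P := by
    ext x
    rw [hΦ, vdiv, hP, SchwartzMap.sum_apply]
    refine Finset.sum_congr rfl fun j _ => ?_
    rw [← aux_fderiv]
    simp only [hec]
    rw [show (fun y => ⟪e j, F y⟫) = f j from funext (hf j)]
  have hPb : P = ∑ j, sD (b j) (S (b j)) := by
    have h1 : ∀ j, sD (b j) (S (b j)) = ∑ k, ⟪b j, e k⟫ • sD (b j) (f k) := by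
      intro j
      simp only [hSdef, sD_sum, sD_smul, real_inner_comm]
    simp only [h1]
    rw [Finset.sum_comm, hP]
    refine Finset.sum_congr rfl fun k _ => ?_
    conv_lhs => rw [← b.sum_repr' (e k)]
    rw [sD_left_sum]
    simp only [sD_left_smul]
  set Q : Fin d → SchwartzMap (EuclideanSpace ℝ (Fin d)) ℝ :=
    fun k => ∑ j, sD (b j) (sD (b j) (S (b k))) - sD (b k) P with hQdef
  have hlap : ∀ j x, lap (fun y => ⟪e j, F y⟫) x = (∑ i, sD (e i) (sD (e i) (f j))) x := by
    intro j x
    rw [show (fun y => ⟪e j, F y⟫) = f j from funext (hf j), lap, SchwartzMap.sum_apply]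
    refine Finset.sum_congr rfl fun i _ => ?_
    simp only [hec, aux_fderiv]
  have hQ : ∀ k x, ⟪b k, Ψ x⟫ = Q k x := by
    intro k x
    rw [← e.sum_inner_mul_inner (b k) (Ψ x)]
    have h2 : Q k = ∑ j, ⟪b k, e j⟫ • ((∑ i, sD (e i) (sD (e i) (f j))) - sD (e j) P) := by
      simp only [hQdef]
      rw [sD_lap b e]
      simp only [smul_sub, Finset.sum_sub_distrib]
      congr 1
      · simp only [hSdef, sD_sum, sD_smul, Finset.smul_sum]
        rw [Finset.sum_comm]
        simp only [real_inner_comm]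
      · conv_lhs => rw [← e.sum_repr' (b k)]
        rw [sD_left_sum]
        simp only [sD_left_smul, real_inner_comm]
    rw [h2, SchwartzMap.sum_apply]
    refine Finset.sum_congr rfl fun j _ => ?_
    rw [hΨ, hlap, hPΦ, aux_fderiv]
    simp
  have hder : ∀ (h : SchwartzMap (EuclideanSpace ℝ (Fin d)) ℝ) q,
      HasDerivAt (fun q => RL (b i₀) q h) (RL (b i₀) q (sD (b i₀) h)) q :=
    fun h q => aux_deriv h (b i₀) q
  have hgen : ∀ (h : Fin d → SchwartzMap (EuclideanSpace ℝ (Fin d)) ℝ) q,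
      HasDerivAt (fun q => ∑ j ∈ Finset.univ.erase i₀, RL (b i₀) q (h j) • b j)
        (∑ j ∈ Finset.univ.erase i₀, RL (b i₀) q (sD (b i₀) (h j)) • b j) q :=
    fun h q => HasDerivAt.fun_sum fun j _ => (hder (h j) q).smul_const (b j)
  have hg' : g = fun q => ∑ j ∈ Finset.univ.erase i₀, RL (b i₀) q (S (b j)) • b j := by
    funext q
    rw [hg]
    refine Finset.sum_congr rfl fun j _ => ?_
    rw [Dlong, ← show (S (b j) : EuclideanSpace ℝ (Fin d) → ℝ) = _ from funext (hS (b j))]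
    rfl
  have hdg : deriv g = fun q =>
      ∑ j ∈ Finset.univ.erase i₀, RL (b i₀) q (sD (b i₀) (S (b j))) • b j := by
    funext q
    rw [hg']
    exact (hgen _ q).deriv
  refine ⟨fun q => ?_, fun q => ?_, ?_⟩
  · rw [hg']; exact (hgen _ q).differentiableAt
  · rw [hdg]; exact (hgen _ q).differentiableAt
  rw [hdg, (hgen _ p).deriv]
  have hz : ∀ (h : SchwartzMap (EuclideanSpace ℝ (Fin d)) ℝ) j, j ≠ i₀ →
      RL (b i₀) p (sD (b j) h) = 0 := by
    intro h j hj
    exact aux_zero h (b i₀) (b j) (b.orthonormal.2 hj.symm) p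
  have hR : RadonVec Ψ (b i₀) p = ∑ k, RL (b i₀) p (Q k) • b k := by
    have h3 : Ψ = fun x => ∑ k, Q k x • b k := by
      funext x
      rw [← b.sum_repr' (Ψ x)]
      simp only [hQ]
    rw [RadonVec, h3]
    rw [integral_finset_sum _ fun k _ => (aux_int (Q k) (b i₀) p).smul_const (b k)]
    refine Finset.sum_congr rfl fun k _ => ?_
    rw [integral_smul_const]
    rfl
  have hL : ∀ k, RL (b i₀) p (∑ j, sD (b j) (sD (b j) (S (b k)))) =
      RL (b i₀) p (sD (b i₀) (sD (b i₀) (S (b k)))) := by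
    intro k
    rw [map_sum]
    exact Finset.sum_eq_single i₀ (fun j _ hj => hz _ j hj) (by simp)
  rw [hR, ← Finset.add_sum_erase _ _ (Finset.mem_univ i₀)]
  have h0 : RL (b i₀) p (Q i₀) = 0 := by
    simp only [hQdef]
    rw [map_sub, hL, hPb, sD_sum Finset.univ (b i₀) (fun j => sD (b j) (S (b j))), map_sum,
      Finset.sum_eq_single i₀ (fun j _ hj => by rw [aux_comm]; exact hz _ j hj) (by simp), sub_self]
  rw [h0, zero_smul, zero_add]
  refine Finset.sum_congr rfl fun k hk => ?_
  simp only [hQdef]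
  rw [map_sub, hL, hz _ k (Finset.ne_of_mem_erase hk), sub_zero]
end
end

section
/- Let d ≥ 2 and let F : EuclideanSpace ℝ (Fin d) → EuclideanSpace ℝ (Fin d) be a vector field each of whose components is a Schwartz function, and let Φ = div F. Then for every pair of orthonormal vectors ω, θ in ℝ^d and every p ∈ ℝ, the function p' ↦ [W_θ^⊥F](ω,p') is differentiable at p with derivative d/dp [W_θ^⊥F](ω,p) = [D_θ^∥F](ω,p) + [R(x ↦ ⟪θ,x⟫·Φ(x))](ω,p). -/
open MeasureTheory Real
open scoped RealInnerProductSpace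

noncomputable section

section helpers

variable {d : ℕ}


lemma haar_inst (ω : EuclideanSpace ℝ (Fin d)) :
    (volume : Measure ((ℝ ∙ ω)ᗮ : Submodule ℝ (EuclideanSpace ℝ (Fin d)))).IsAddHaarMeasure := by
  infer_instance

lemma norm_le_of_perp (ω : EuclideanSpace ℝ (Fin d))
    (y : ((ℝ ∙ ω)ᗮ : Submodule ℝ (EuclideanSpace ℝ (Fin d)))) (p : ℝ) :
    ‖y‖ ≤ ‖p • ω + (y : EuclideanSpace ℝ (Fin d))‖ := by
  have h : ⟪p • ω, (y : EuclideanSpace ℝ (Fin d))⟫ = 0 := by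
    rw [real_inner_smul_left, Submodule.mem_orthogonal_singleton_iff_inner_right.1 y.2, mul_zero]
  have h2 := norm_add_sq_eq_norm_sq_add_norm_sq_of_inner_eq_zero _ _ h
  have h3 : ‖y‖ = ‖(y : EuclideanSpace ℝ (Fin d))‖ := rfl
  rw [h3]
  apply le_of_sq_le_sq _ (norm_nonneg _)
  nlinarith [mul_self_nonneg ‖p • ω‖]

lemma schwartz_bound (f : SchwartzMap (EuclideanSpace ℝ (Fin d)) ℝ)
    (ω : EuclideanSpace ℝ (Fin d)) :
    ∃ b : ((ℝ ∙ ω)ᗮ : Submodule ℝ (EuclideanSpace ℝ (Fin d))) → ℝ, Integrable b ∧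
      ∀ (p : ℝ) (y : ((ℝ ∙ ω)ᗮ : Submodule ℝ (EuclideanSpace ℝ (Fin d)))),
        ‖f (p • ω + (y : EuclideanSpace ℝ (Fin d)))‖ ≤ b y := by
  set k : ℕ := Module.finrank ℝ ((ℝ ∙ ω)ᗮ : Submodule ℝ (EuclideanSpace ℝ (Fin d))) + 1
  obtain ⟨C, hC⟩ : ∃ C : ℝ, ∀ x, (1 + ‖x‖) ^ k * ‖f x‖ ≤ C := by
    refine ⟨2 ^ k * (Finset.Iic (k, 0)).sup (fun m => SchwartzMap.seminorm ℝ m.1 m.2) f,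
      fun x => ?_⟩
    have := SchwartzMap.one_add_le_sup_seminorm_apply (𝕜 := ℝ) (m := (k, 0)) (k := k) (n := 0)
      le_rfl le_rfl f x
    rw [norm_iteratedFDeriv_zero] at this
    exact this
  refine ⟨fun y => C * (1 + ‖y‖) ^ (-(k : ℝ)), ?_, ?_⟩
  · apply Integrable.const_mul
    apply integrable_one_add_norm
    simp [k]
  · intro p y
    have h1 := hC (p • ω + (y : EuclideanSpace ℝ (Fin d)))
    have h2 : (1 + ‖y‖) ^ k ≤ (1 + ‖p • ω + (y : EuclideanSpace ℝ (Fin d))‖) ^ k := by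
      gcongr
      exact norm_le_of_perp ω y p
    have h3 : 0 < (1 + ‖y‖) ^ k := by positivity
    beta_reduce
    rw [Real.rpow_neg (by positivity), Real.rpow_natCast, ← div_eq_mul_inv, le_div_iff₀ h3, mul_comm]
    exact (mul_le_mul_of_nonneg_right h2 (norm_nonneg _)).trans h1

lemma schwartz_integrable (f : SchwartzMap (EuclideanSpace ℝ (Fin d)) ℝ)
    (ω : EuclideanSpace ℝ (Fin d)) (p : ℝ) :
    Integrable (fun y : ((ℝ ∙ ω)ᗮ : Submodule ℝ (EuclideanSpace ℝ (Fin d))) =>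
      f (p • ω + (y : EuclideanSpace ℝ (Fin d)))) := by
  obtain ⟨b, hb, h⟩ := schwartz_bound f ω
  refine hb.mono' ?_ (Filter.Eventually.of_forall (h p))
  exact (f.continuous.comp (by fun_prop)).aestronglyMeasurable

open LineDeriv in
lemma radon_hasDerivAt (f : SchwartzMap (EuclideanSpace ℝ (Fin d)) ℝ)
    (ω : EuclideanSpace ℝ (Fin d)) (p : ℝ) :
    HasDerivAt (fun p' => RadonT f ω p') (RadonT (∂_{ω} f : SchwartzMap _ ℝ) ω p) p := by
  obtain ⟨b, hb, h⟩ := schwartz_bound (∂_{ω} f) ω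
  refine (hasDerivAt_integral_of_dominated_loc_of_deriv_le (s := Set.univ) (bound := b)
    (F := fun p' (y : ((ℝ ∙ ω)ᗮ : Submodule ℝ (EuclideanSpace ℝ (Fin d)))) =>
      f (p' • ω + (y : EuclideanSpace ℝ (Fin d))))
    (F' := fun p' y => (∂_{ω} f : SchwartzMap _ ℝ) (p' • ω + (y : EuclideanSpace ℝ (Fin d))))
    Filter.univ_mem ?_ (schwartz_integrable f ω p)
    (schwartz_integrable (∂_{ω} f) ω p).aestronglyMeasurable ?_ hb ?_).2
  · exact Filter.Eventually.of_forall fun q => (schwartz_integrable f ω q).aestronglyMeasurable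
  · exact Filter.Eventually.of_forall fun y q _ => h q y
  · refine Filter.Eventually.of_forall fun y q _ => ?_
    have h1 : HasDerivAt (fun q : ℝ => q • ω + (y : EuclideanSpace ℝ (Fin d))) ω q := by
      simpa using ((hasDerivAt_id q).smul_const ω).add_const (y : EuclideanSpace ℝ (Fin d))
    exact (f.hasFDerivAt (q • ω + (y : EuclideanSpace ℝ (Fin d)))).comp_hasDerivAt q h1

open LineDeriv in
lemma radon_tangential (f : SchwartzMap (EuclideanSpace ℝ (Fin d)) ℝ)
    (ω u : EuclideanSpace ℝ (Fin d)) (hu : ⟪ω, u⟫ = 0) (p : ℝ) :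
    RadonT (∂_{u} f : SchwartzMap _ ℝ) ω p = 0 := by
  let v : ((ℝ ∙ ω)ᗮ : Submodule ℝ (EuclideanSpace ℝ (Fin d))) :=
    ⟨u, Submodule.mem_orthogonal_singleton_iff_inner_right.2 hu⟩
  let g : ((ℝ ∙ ω)ᗮ : Submodule ℝ (EuclideanSpace ℝ (Fin d))) → ℝ :=
    fun y => f (p • ω + (y : EuclideanSpace ℝ (Fin d)))
  have hg : ∀ y : ((ℝ ∙ ω)ᗮ : Submodule ℝ (EuclideanSpace ℝ (Fin d))),
      HasFDerivAt g ((fderiv ℝ f (p • ω + (y : EuclideanSpace ℝ (Fin d)))).comp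
      ((ℝ ∙ ω)ᗮ : Submodule ℝ (EuclideanSpace ℝ (Fin d))).subtypeL) y := by
    intro y
    have h1 : HasFDerivAt (fun y : ((ℝ ∙ ω)ᗮ : Submodule ℝ (EuclideanSpace ℝ (Fin d))) =>
      p • ω + (y : EuclideanSpace ℝ (Fin d)))
      ((ℝ ∙ ω)ᗮ : Submodule ℝ (EuclideanSpace ℝ (Fin d))).subtypeL y :=
      (((ℝ ∙ ω)ᗮ : Submodule ℝ (EuclideanSpace ℝ (Fin d))).subtypeL.hasFDerivAt).const_add _
    exact (f.hasFDerivAt (p • ω + (y : EuclideanSpace ℝ (Fin d)))).comp y h1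
  have hg' : ∀ y : ((ℝ ∙ ω)ᗮ : Submodule ℝ (EuclideanSpace ℝ (Fin d))),
      fderiv ℝ g y v =
      (∂_{u} f : SchwartzMap _ ℝ) (p • ω + (y : EuclideanSpace ℝ (Fin d))) := by
    intro y
    rw [(hg y).fderiv]
    rfl
  have := integral_mul_fderiv_eq_neg_fderiv_mul_of_integrable (f := fun _ => (1 : ℝ)) (g := g)
    (v := v) (μ := volume) (by simp)
    (by simpa only [one_mul, hg'] using schwartz_integrable (∂_{u} f) ω p)
    (by simpa only [one_mul] using schwartz_integrable f ω p)
    (fun _ _ => differentiableAt_const _) (fun y _ => (hg y).differentiableAt)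
  unfold RadonT
  simpa [hg'] using this

lemma inner_canE (j : Fin d) (x : EuclideanSpace ℝ (Fin d)) : ⟪canE d j, x⟫ = x j := by
  simp [canE, EuclideanSpace.inner_single_left]

lemma sum_comp (v x : EuclideanSpace ℝ (Fin d)) : ⟪v, x⟫ = ∑ j, v j * x j := by
  simp [PiLp.inner_apply, mul_comm]

end helpers

/-- derivative in `p` of the weighted transversal transform:
`d/dp [W_θ^⊥F](ω,p) = [D_θ^∥F](ω,p) + [R(⟪θ,x⟫Φ)](ω,p)`. -/
theorem stmt12 (d : ℕ) (hd : 2 ≤ d)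
    (F : EuclideanSpace ℝ (Fin d) → EuclideanSpace ℝ (Fin d))
    (hF : ∀ j : Fin d, IsSchwartz (fun x => ⟪canE d j, F x⟫))
    (Φ : EuclideanSpace ℝ (Fin d) → ℝ) (hΦ : ∀ x, Φ x = vdiv F x) :
    ∀ ω θ : EuclideanSpace ℝ (Fin d), ‖ω‖ = 1 → ‖θ‖ = 1 → ⟪ω, θ⟫ = 0 → ∀ p : ℝ,
      HasDerivAt (fun p' => Wperp F ω θ p')
        (Dlong F ω θ p + RadonT (fun x => ⟪θ, x⟫ * Φ x) ω p) p := by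
  intro ω θ hω hθ hωθ p
  choose g hg using hF
  let ℓ : EuclideanSpace ℝ (Fin d) →L[ℝ] ℝ := innerSL ℝ θ
  have hℓ : Function.HasTemperateGrowth (fun x => ℓ x) := ℓ.hasTemperateGrowth
  let m : Fin d → SchwartzMap (EuclideanSpace ℝ (Fin d)) ℝ :=
    fun j => SchwartzMap.smulLeftCLM ℝ (fun x => ℓ x) (g j)
  have hm : ∀ j x, m j x = ⟪θ, x⟫ * g j x := fun j x =>
    SchwartzMap.smulLeftCLM_apply_apply hℓ (g j) x
  have hFd : ∀ v x, ⟪v, F x⟫ = ∑ j, v j * g j x := by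
    intro v x
    rw [sum_comp]
    simp only [← hg, inner_canE]
  have hmd : ∀ j u x, (LineDeriv.lineDerivOp u (m j) : SchwartzMap _ ℝ) x
      = ⟪θ, u⟫ * g j x + ⟪θ, x⟫ * fderiv ℝ (g j) x u := by
    intro j u x
    rw [SchwartzMap.lineDerivOp_apply_eq_fderiv]
    have h1 : HasFDerivAt (fun x => ℓ x * g j x) (ℓ x • fderiv ℝ (g j) x + g j x • ℓ) x :=
      ℓ.hasFDerivAt.mul ((g j).hasFDerivAt x)
    have h2 : (m j : EuclideanSpace ℝ (Fin d) → ℝ) = fun x => ℓ x * g j x := by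
      funext x; exact hm j x
    rw [h2, h1.fderiv]
    simp [ℓ]
    ring
  let h : SchwartzMap (EuclideanSpace ℝ (Fin d)) ℝ := ∑ j, ω j • m j
  have hh : ∀ x, h x = ⟪θ, x⟫ * ⟪ω, F x⟫ := by
    intro x
    simp only [h, SchwartzMap.sum_apply, SchwartzMap.smul_apply, hm, hFd, Finset.mul_sum, smul_eq_mul]
    exact Finset.sum_congr rfl fun j _ => by ring
  have hW : (fun p' => Wperp F ω θ p') = fun p' => RadonT h ω p' := by
    funext q
    unfold Wperp
    congr 1
    funext x
    exact (hh x).symm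
  have hθω : ⟪θ, ω⟫ = 0 := by rw [real_inner_comm]; exact hωθ
  rw [hW]
  convert radon_hasDerivAt h ω p using 1
  -- tangential vectors
  let u : Fin d → EuclideanSpace ℝ (Fin d) := fun j => canE d j - ω j • ω
  have hu : ∀ j, ⟪ω, u j⟫ = 0 := by
    intro j
    simp only [u, inner_sub_right, real_inner_smul_right, real_inner_self_eq_norm_sq, hω]
    rw [real_inner_comm, inner_canE]; ring
  have hθu : ∀ j, ⟪θ, u j⟫ = θ j := by
    intro j
    simp only [u, inner_sub_right, real_inner_smul_right, hθω]
    rw [real_inner_comm, inner_canE]; ring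
  let T : SchwartzMap (EuclideanSpace ℝ (Fin d)) ℝ :=
    ∑ j, (LineDeriv.lineDerivOp (u j) (m j) : SchwartzMap (EuclideanSpace ℝ (Fin d)) ℝ)
  have hT : RadonT T ω p = 0 := by
    have : RadonT T ω p = ∑ j, RadonT (LineDeriv.lineDerivOp (u j) (m j) :
        SchwartzMap (EuclideanSpace ℝ (Fin d)) ℝ) ω p := by
      unfold RadonT
      rw [← integral_finsetSum _ (fun j _ => schwartz_integrable _ ω p)]
      simp only [T, SchwartzMap.sum_apply]
    rw [this]
    exact Finset.sum_eq_zero fun j _ => radon_tangential (m j) ω (u j) (hu j) p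
  -- the longitudinal integrand
  let L : SchwartzMap (EuclideanSpace ℝ (Fin d)) ℝ := ∑ j, θ j • g j
  have hL : ∀ x, L x = ⟪θ, F x⟫ := by
    intro x
    simp only [L, SchwartzMap.sum_apply, SchwartzMap.smul_apply, hFd, smul_eq_mul]
  have hD : Dlong F ω θ p = RadonT L ω p := by
    unfold Dlong
    congr 1
    funext x
    exact (hL x).symm
  let D : SchwartzMap (EuclideanSpace ℝ (Fin d)) ℝ := LineDeriv.lineDerivOp ω h
  have hDx : ∀ x, D x = ∑ j, ω j * (⟪θ, x⟫ * fderiv ℝ (g j) x ω) := by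
    intro x
    simp only [D, h, LineDeriv.lineDerivOp_sum, LineDeriv.lineDerivOp_smul, SchwartzMap.sum_apply,
      SchwartzMap.smul_apply, hmd, hθω, zero_mul, zero_add, smul_eq_mul]
  have hdiv : ∀ x, ⟪θ, x⟫ * Φ x = D x + T x - L x := by
    intro x
    rw [hDx, hΦ]
    simp only [vdiv, T, L, SchwartzMap.sum_apply, SchwartzMap.smul_apply, hmd, hθu, smul_eq_mul]
    rw [← Finset.sum_add_distrib, ← Finset.sum_sub_distrib, Finset.mul_sum]
    refine Finset.sum_congr rfl fun j _ => ?_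
    have h1 : (fun y => ⟪canE d j, F y⟫) = g j := funext (hg j)
    rw [h1]
    simp only [u, map_sub, map_smul, smul_eq_mul]
    ring
  have hR : RadonT (fun x => ⟪θ, x⟫ * Φ x) ω p = RadonT D ω p + RadonT T ω p - RadonT L ω p := by
    unfold RadonT
    simp only [hdiv]
    rw [integral_sub, integral_add]
    · exact schwartz_integrable D ω p
    · exact schwartz_integrable T ω p
    · exact (schwartz_integrable D ω p).add (schwartz_integrable T ω p)
    · exact schwartz_integrable L ω p
  rw [hD, hR, hT]
  ring
end
end

section
/- Let d ≥ 2 and let φ : EuclideanSpace ℝ (Fin d) → ℝ be twice continuously differentiable with ‖∇φ(x)‖ ≤ C·(1+‖x‖)^{-d} and with all second partial derivatives bounded by C·(1+‖x‖)^{-d-1}, for all x and some constant C ≥ 0. Then for every pair of orthonormal vectors ω, ω_1 in ℝ^d, every index k ∈ {1,…,d} and every p ∈ ℝ, the following integration-by-parts identity on the hyperplane holds: ∫_{y ∈ (ℝ∙ω)ᗮ} ⟪ω_1, p•ω+y⟫ · ⟪ω_1, ∇(∂φ/∂x_k)(p•ω+y)⟫ dy = − ∫_{y ∈ (ℝ∙ω)ᗮ}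 (∂φ/∂x_k)(p•ω+y) dy. -/
open MeasureTheory Real
open scoped RealInnerProductSpace

noncomputable section

lemma aux_ibp {V : Type*} [NormedAddCommGroup V] [InnerProductSpace ℝ V] [FiniteDimensional ℝ V]
    [MeasurableSpace V] [BorelSpace V] (u : V → ℝ) (hu : Differentiable ℝ u) (v : V)
    (h1 : Integrable (fun y => (1 + ‖y‖)⁻¹ * u y))
    (h2 : Integrable (fun y => fderiv ℝ u y v)) :
    ∫ y, fderiv ℝ u y v = 0 := by
  let ε : ℕ → ℝ := fun n => 1 / ((n : ℝ) + 1)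
  have hε0 : ∀ n, 0 < ε n := fun n => by positivity
  have hε1 : ∀ n, ε n ≤ 1 := fun n => by
    simp only [ε]
    rw [div_le_one (by positivity)]
    have : (0 : ℝ) ≤ n := by positivity
    linarith
  have hεt : Filter.Tendsto ε Filter.atTop (nhds 0) := tendsto_one_div_add_atTop_nhds_zero_nat
  let ψ : ℕ → V → ℝ := fun n y => (1 + ε n * ‖y‖ ^ 2)⁻¹
  have hpos : ∀ n (y : V), 0 < 1 + ε n * ‖y‖ ^ 2 := fun n y => by
    have := hε0 n
    positivity
  have hψd : ∀ n y, HasFDerivAt (ψ n)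
      (-((1 + ε n * ‖y‖ ^ 2) ^ 2)⁻¹ • (ε n • (2 • (innerSL ℝ y)))) y := fun n y => by
    have h := ((hasStrictFDerivAt_norm_sq y).hasFDerivAt.const_mul (ε n)).const_add (1 : ℝ)
    exact (hasDerivAt_inv (hpos n y).ne').comp_hasFDerivAt y h
  have hψv : ∀ n y, fderiv ℝ (ψ n) y v
      = -((1 + ε n * ‖y‖ ^ 2) ^ 2)⁻¹ * (ε n * (2 * ⟪y, v⟫)) := fun n y => by
    rw [(hψd n y).fderiv]; simp
  have hψc : ∀ n, Continuous (ψ n) := fun n =>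
    continuous_iff_continuousAt.2 fun y => (hψd n y).continuousAt
  have hψ'c : ∀ n, Continuous (fun y => fderiv ℝ (ψ n) y v) := fun n => by
    simp_rw [hψv]
    refine Continuous.mul ?_ (by fun_prop)
    refine Continuous.neg (Continuous.inv₀ (by fun_prop) fun y => ?_)
    exact (pow_pos (hpos n y) 2).ne'
  have hψ1 : ∀ n y, ‖ψ n y‖ ≤ 1 := fun n y => by
    rw [Real.norm_of_nonneg (inv_pos.2 (hpos n y)).le]
    apply inv_le_one_of_one_le₀
    have := hε0 n
    have : 0 ≤ ε n * ‖y‖ ^ 2 := by positivity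
    linarith
  have hψ'b : ∀ n y, ‖fderiv ℝ (ψ n) y v‖ ≤ 4 * ‖v‖ * (1 + ‖y‖)⁻¹ := fun n y => by
    rw [hψv, norm_mul, norm_neg, norm_inv, Real.norm_of_nonneg (pow_pos (hpos n y) 2).le,
      norm_mul, norm_mul, Real.norm_of_nonneg (hε0 n).le]
    have hi := norm_inner_le_norm (𝕜 := ℝ) y v
    have e0 := hε0 n
    have e1 := hε1 n
    have hP := hpos n y
    have ny := norm_nonneg y
    have key : ε n * ‖y‖ * (1 + ‖y‖) ≤ 2 * (1 + ε n * ‖y‖ ^ 2) ^ 2 := by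
      have a : ε n * ‖y‖ * (1 + ‖y‖) ≤ 2 * (1 + ε n * ‖y‖ ^ 2) := by
        nlinarith [mul_nonneg e0.le (sq_nonneg (‖y‖ - 1))]
      have b : 0 ≤ ε n * ‖y‖ ^ 2 := by positivity
      nlinarith
    rw [inv_mul_le_iff₀ (by positivity), ← div_eq_mul_inv, mul_div_assoc', le_div_iff₀ (by positivity)]
    have h2 : ‖(2 : ℝ)‖ = 2 := by norm_num
    rw [h2]
    calc ε n * (2 * ‖⟪y, v⟫‖) * (1 + ‖y‖) ≤ ε n * (2 * (‖y‖ * ‖v‖)) * (1 + ‖y‖) := by gcongr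
      _ = 2 * ‖v‖ * (ε n * ‖y‖ * (1 + ‖y‖)) := by ring
      _ ≤ 2 * ‖v‖ * (2 * (1 + ε n * ‖y‖ ^ 2) ^ 2) := by gcongr
      _ = _ := by ring
  have hum := hu.continuous
  have hψb : ∀ n y, ‖ψ n y‖ ≤ (2 / ε n) * (1 + ‖y‖)⁻¹ := fun n y => by
    rw [Real.norm_of_nonneg (inv_pos.2 (hpos n y)).le, ← div_eq_mul_inv, div_div]
    have e0 := hε0 n
    have e1 := hε1 n
    rw [inv_le_comm₀ (hpos n y) (by positivity), inv_div, div_le_iff₀ (by norm_num)]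
    nlinarith [mul_nonneg e0.le (sq_nonneg (‖y‖ - 1)), norm_nonneg y]
  have i1 : ∀ n, Integrable (fun y => fderiv ℝ (ψ n) y v * u y) := fun n => by
    refine (h1.norm.const_mul (4 * ‖v‖)).mono' ((hψ'c n).mul hum).aestronglyMeasurable
      (.of_forall fun y => ?_)
    rw [norm_mul, norm_mul, Real.norm_of_nonneg (by positivity : 0 ≤ (1 + ‖y‖)⁻¹), ← mul_assoc]
    exact mul_le_mul_of_nonneg_right (hψ'b n y) (norm_nonneg _)
  have i2 : ∀ n, Integrable (fun y => ψ n y * fderiv ℝ u y v) := fun n =>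
    h2.bdd_mul (hψc n).aestronglyMeasurable (.of_forall (hψ1 n))
  have i3 : ∀ n, Integrable (fun y => ψ n y * u y) := fun n => by
    refine (h1.norm.const_mul (2 / ε n)).mono' ((hψc n).mul hum).aestronglyMeasurable
      (.of_forall fun y => ?_)
    rw [norm_mul, norm_mul, Real.norm_of_nonneg (by positivity : 0 ≤ (1 + ‖y‖)⁻¹), ← mul_assoc]
    exact mul_le_mul_of_nonneg_right (hψb n y) (norm_nonneg _)
  have hI : ∀ n, ∫ y, ψ n y * fderiv ℝ u y v = - ∫ y, fderiv ℝ (ψ n) y v * u y := fun n =>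
    integral_mul_fderiv_eq_neg_fderiv_mul_of_integrable (i1 n) (i2 n) (i3 n)
      (fun y _ => (hψd n y).differentiableAt) (fun y _ => hu y)
  have hden : ∀ y : V, Filter.Tendsto (fun n => 1 + ε n * ‖y‖ ^ 2) Filter.atTop (nhds 1) :=
    fun y => by simpa using (hεt.mul_const (‖y‖ ^ 2)).const_add 1
  have t1 : Filter.Tendsto (fun n => ∫ y, ψ n y * fderiv ℝ u y v) Filter.atTop
      (nhds (∫ y, fderiv ℝ u y v)) := by
    refine tendsto_integral_of_dominated_convergence (fun y => ‖fderiv ℝ u y v‖)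
      (fun n => (i2 n).aestronglyMeasurable) h2.norm (fun n => .of_forall fun y => ?_)
      (.of_forall fun y => ?_)
    · rw [norm_mul]
      exact mul_le_of_le_one_left (norm_nonneg _) (hψ1 n y)
    · simpa using ((hden y).inv₀ one_ne_zero).mul_const (fderiv ℝ u y v)
  have t2 : Filter.Tendsto (fun n => ∫ y, fderiv ℝ (ψ n) y v * u y) Filter.atTop
      (nhds (∫ _y : V, (0 : ℝ))) := by
    refine tendsto_integral_of_dominated_convergence
      (fun y => 4 * ‖v‖ * ‖(1 + ‖y‖)⁻¹ * u y‖)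
      (fun n => (i1 n).aestronglyMeasurable) (h1.norm.const_mul _) (fun n => .of_forall fun y => ?_)
      (.of_forall fun y => ?_)
    · rw [norm_mul, norm_mul, Real.norm_of_nonneg (by positivity : 0 ≤ (1 + ‖y‖)⁻¹), ← mul_assoc]
      exact mul_le_mul_of_nonneg_right (hψ'b n y) (norm_nonneg _)
    · simp_rw [hψv]
      have := (((((hden y).pow 2).inv₀ (by norm_num)).neg).mul
        (hεt.mul_const (2 * ⟪y, v⟫))).mul_const (u y)
      simpa using this
  have t3 := t2.neg
  simp_rw [← hI] at t3
  simpa using tendsto_nhds_unique t1 t3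

/-- integration by parts on the hyperplane:
`∫ ⟪ω₁,x⟫ ⟪ω₁, ∇(∂φ/∂x_k)(x)⟫ dx = − ∫ (∂φ/∂x_k)(x) dx` over `Π(ω,p)`. -/
theorem stmt13 (d : ℕ) (hd : 2 ≤ d)
    (φ : EuclideanSpace ℝ (Fin d) → ℝ) (hreg : ContDiff ℝ 2 φ)
    (C : ℝ) (hC : 0 ≤ C)
    (hgradb : ∀ x, ‖gradient φ x‖ ≤ C * (1 + ‖x‖) ^ (-(d : ℝ)))
    (hsecond : ∀ (j k : Fin d) x,
      |fderiv ℝ (fun y => fderiv ℝ φ y (canE d j)) x (canE d k)| ≤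
        C * (1 + ‖x‖) ^ (-((d : ℝ) + 1))) :
    ∀ ω ω₁ : EuclideanSpace ℝ (Fin d), ‖ω‖ = 1 → ‖ω₁‖ = 1 → ⟪ω, ω₁⟫ = 0 →
      ∀ (k : Fin d) (p : ℝ),
        RadonT (fun x => ⟪ω₁, x⟫ *
            ⟪ω₁, gradient (fun z => fderiv ℝ φ z (canE d k)) x⟫) ω p =
          -RadonT (fun x => fderiv ℝ φ x (canE d k)) ω p := by
  intro ω ω₁ hω hω₁ hort k p
  haveI : Fact (Module.finrank ℝ (EuclideanSpace ℝ (Fin d)) = (d - 1) + 1) :=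
    ⟨by rw [finrank_euclideanSpace_fin]; omega⟩
  have hω0 : ω ≠ 0 := by
    rintro rfl
    simp at hω
  have hfr : Module.finrank ℝ ((ℝ ∙ ω)ᗮ : Submodule ℝ (EuclideanSpace ℝ (Fin d))) = d - 1 :=
    Submodule.finrank_orthogonal_span_singleton hω0
  set V := ((ℝ ∙ ω)ᗮ : Submodule ℝ (EuclideanSpace ℝ (Fin d))) with hV
  have hfr' : (Module.finrank ℝ V : ℝ) < d := by
    rw [hfr]
    exact_mod_cast (by omega : d - 1 < d)
  have hW : Integrable (fun y : V => (1 + ‖y‖) ^ (-(d : ℝ))) := integrable_one_add_norm hfr'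
  set g : EuclideanSpace ℝ (Fin d) → ℝ := fun z => fderiv ℝ φ z (canE d k) with hg
  have hgC : ContDiff ℝ 1 g := (hreg.fderiv_right (m := 1) (by norm_num)).clm_apply contDiff_const
  have hgd : Differentiable ℝ g := hgC.differentiable (by norm_num)
  have hgc : Continuous g := hgC.continuous
  have hg'c : Continuous (fun x => fderiv ℝ g x ω₁) :=
    (hgC.continuous_fderiv (by norm_num)).clm_apply continuous_const
  have hgrad : ∀ x, ⟪ω₁, gradient g x⟫ = fderiv ℝ g x ω₁ := fun x => by
    rw [real_inner_comm, gradient, InnerProductSpace.toDual_symm_apply]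
  have hcan : ‖canE d k‖ = 1 := by simp [canE]
  have hgb : ∀ x, ‖g x‖ ≤ C * (1 + ‖x‖) ^ (-(d : ℝ)) := fun x => by
    refine le_trans ?_ (hgradb x)
    have : g x = ⟪gradient φ x, canE d k⟫ := by
      rw [gradient, InnerProductSpace.toDual_symm_apply]
    rw [this]
    simpa [hcan] using norm_inner_le_norm (𝕜 := ℝ) (gradient φ x) (canE d k)
  have hg'b : ∀ x, ‖fderiv ℝ g x ω₁‖ ≤ (d * C) * (1 + ‖x‖) ^ (-((d : ℝ) + 1)) := fun x => by
    have hs : ω₁ = ∑ j, ω₁ j • canE d j := by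
      ext i
      simp [canE, Finset.sum_apply, Pi.single_apply]
    have hle : ∀ j, ‖ω₁ j‖ ≤ 1 := fun j => hω₁ ▸ PiLp.norm_apply_le ω₁ j
    calc ‖fderiv ℝ g x ω₁‖ = ‖∑ j, ω₁ j * fderiv ℝ g x (canE d j)‖ := by
          conv_lhs => rw [hs]
          simp
      _ ≤ ∑ j, ‖ω₁ j * fderiv ℝ g x (canE d j)‖ := norm_sum_le _ _
      _ ≤ ∑ _j : Fin d, C * (1 + ‖x‖) ^ (-((d : ℝ) + 1)) := by
          refine Finset.sum_le_sum fun j _ => ?_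
          rw [norm_mul]
          exact (mul_le_of_le_one_left (norm_nonneg _) (hle j)).trans (hsecond k j x)
      _ = _ := by simp; ring
  have hinc : Continuous (fun y : V => p • ω + (y : EuclideanSpace ℝ (Fin d))) := by fun_prop
  have hyω : ∀ y : V, ⟪ω, (y : EuclideanSpace ℝ (Fin d))⟫ = 0 := fun y =>
    (Submodule.mem_orthogonal_singleton_iff_inner_right).1 y.2
  have hnx : ∀ y : V, ‖y‖ ≤ ‖p • ω + (y : EuclideanSpace ℝ (Fin d))‖ := fun y => by
    have h := norm_add_sq_eq_norm_sq_add_norm_sq_of_inner_eq_zero (p • ω)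
      (y : EuclideanSpace ℝ (Fin d)) (by rw [inner_smul_left, hyω]; simp)
    have h2 : ‖y‖ = ‖(y : EuclideanSpace ℝ (Fin d))‖ := rfl
    rw [h2]
    refine abs_le_of_sq_le_sq' ?_ (norm_nonneg _) |>.2
    nlinarith [sq_nonneg ‖p • ω‖]
  have hin : ∀ y : V, ‖⟪ω₁, p • ω + (y : EuclideanSpace ℝ (Fin d))⟫‖ ≤ 1 + ‖y‖ := fun y => by
    rw [inner_add_right, inner_smul_right, real_inner_comm, hort]
    have := norm_inner_le_norm (𝕜 := ℝ) ω₁ (y : EuclideanSpace ℝ (Fin d))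
    rw [hω₁, one_mul] at this
    have h2 : ‖y‖ = ‖(y : EuclideanSpace ℝ (Fin d))‖ := rfl
    rw [mul_zero, zero_add, h2]
    linarith
  have hGb : ∀ y : V, ‖g (p • ω + (y : EuclideanSpace ℝ (Fin d)))‖ ≤ C * (1 + ‖y‖) ^ (-(d : ℝ)) :=
    fun y => by
    refine (hgb _).trans (mul_le_mul_of_nonneg_left ?_ hC)
    exact Real.rpow_le_rpow_of_nonpos (by positivity) (by linarith [hnx y]) (by simp)
  have hG'b : ∀ y : V, ‖fderiv ℝ g (p • ω + (y : EuclideanSpace ℝ (Fin d))) ω₁‖ ≤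
      (d * C) * (1 + ‖y‖) ^ (-((d : ℝ) + 1)) := fun y => by
    refine (hg'b _).trans (mul_le_mul_of_nonneg_left ?_ (by positivity))
    refine Real.rpow_le_rpow_of_nonpos (by positivity) (by linarith [hnx y]) ?_
    have : (0 : ℝ) ≤ d := by positivity
    linarith
  have hIg : Integrable (fun y : V => g (p • ω + (y : EuclideanSpace ℝ (Fin d)))) :=
    (hW.const_mul C).mono' (hgc.comp hinc).aestronglyMeasurable (.of_forall hGb)
  have hIg' : Integrable (fun y : V => ⟪ω₁, p • ω + (y : EuclideanSpace ℝ (Fin d))⟫ *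
      fderiv ℝ g (p • ω + (y : EuclideanSpace ℝ (Fin d))) ω₁) := by
    refine (hW.const_mul (d * C)).mono'
      ((continuous_const.inner hinc).mul (hg'c.comp hinc)).aestronglyMeasurable
      (.of_forall fun y => ?_)
    rw [norm_mul]
    refine (mul_le_mul (hin y) (hG'b y) (norm_nonneg _) (by positivity)).trans (le_of_eq ?_)
    have : (1 + ‖y‖) ^ (-(d : ℝ)) = (1 + ‖y‖) * (1 + ‖y‖) ^ (-((d : ℝ) + 1)) := by
      have hp : 0 < 1 + ‖y‖ := by positivity
      rw [show -(d : ℝ) = 1 + -((d : ℝ) + 1) by ring, Real.rpow_add hp, Real.rpow_one]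
    rw [this]
    ring
  have hv : ω₁ ∈ V := (Submodule.mem_orthogonal_singleton_iff_inner_right).2 hort
  let u : V → ℝ := fun y => ⟪ω₁, p • ω + (y : EuclideanSpace ℝ (Fin d))⟫ *
    g (p • ω + (y : EuclideanSpace ℝ (Fin d)))
  have hA : ∀ y : V, HasFDerivAt (fun y : V => p • ω + (y : EuclideanSpace ℝ (Fin d)))
      V.subtypeL y := fun y => (V.subtypeL.hasFDerivAt).const_add _
  have hud : ∀ y : V, HasFDerivAt u (⟪ω₁, p • ω + (y : EuclideanSpace ℝ (Fin d))⟫ •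
      ((fderiv ℝ g (p • ω + (y : EuclideanSpace ℝ (Fin d)))).comp V.subtypeL) +
      g (p • ω + (y : EuclideanSpace ℝ (Fin d))) • ((innerSL ℝ ω₁).comp V.subtypeL)) y := fun y =>
    (((innerSL ℝ ω₁).hasFDerivAt).comp y (hA y)).mul (((hgd _).hasFDerivAt).comp y (hA y))
  have huv : ∀ y : V, fderiv ℝ u y ⟨ω₁, hv⟩ = ⟪ω₁, p • ω + (y : EuclideanSpace ℝ (Fin d))⟫ *
      fderiv ℝ g (p • ω + (y : EuclideanSpace ℝ (Fin d))) ω₁ +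
      g (p • ω + (y : EuclideanSpace ℝ (Fin d))) := fun y => by
    rw [(hud y).fderiv]
    simp [hω₁]
  have hu : Differentiable ℝ u := fun y => (hud y).differentiableAt
  have key := aux_ibp u hu ⟨ω₁, hv⟩ (by
    refine (hW.const_mul C).mono' (Continuous.aestronglyMeasurable ?_) (.of_forall fun y => ?_)
    · exact (Continuous.inv₀ (by fun_prop) fun y => by positivity).mul hu.continuous
    · have hp : 0 < 1 + ‖y‖ := by positivity
      rw [norm_mul, norm_inv, Real.norm_of_nonneg hp.le, inv_mul_le_iff₀ hp, norm_mul]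
      exact mul_le_mul (hin y) (hGb y) (norm_nonneg _) hp.le)
    (by simp_rw [huv]; exact hIg'.add hIg)
  simp_rw [huv] at key
  rw [integral_add hIg' hIg] at key
  unfold RadonT
  simp_rw [hgrad]
  linarith
end
end

section
/- Let d ≥ 3 and let F : EuclideanSpace ℝ (Fin d) → EuclideanSpace ℝ (Fin d) be a vector field each of whose components is a Schwartz function. Let Φ = div F, let G(x) = −(Γ(d/2−1)/(4π^{d/2}))·‖x‖^{2−d}, and define Ψ : ℝ^d → ℝ^d componentwise by ⟪e_j, Ψ(x)⟫ = Δ(F_j)(x) − ∂Φ/∂x_j(x), where F_j(x) = ⟪e_j, F(x)⟫. Then for every x ∈ ℝ^d, F(x) = ∫_{ℝ^d} Φ(y)·(∇G)(x−y) dy + ∫_{ℝ^d} G(x−y)·Ψ(y) dy, where both integrals converge (the second is a Bochner integral). -/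
open MeasureTheory Real
open scoped RealInnerProductSpace

noncomputable section

open Set Filter Topology LineDeriv SchwartzMap

abbrev Eu (d : ℕ) := EuclideanSpace ℝ (Fin d)

lemma eu_nontrivial {d : ℕ} (hd : 3 ≤ d) : Nontrivial (Eu d) := by
  have : 0 < Module.finrank ℝ (Eu d) := by simp; omega
  exact Module.nontrivial_of_finrank_pos this

lemma integrable_ker {d : ℕ} (hd : 3 ≤ d) {s : ℝ} (hs0 : 0 ≤ s) (hs : s < d)
    {h : Eu d → ℝ} (hi : Integrable h volume) {C : ℝ} (hC : ∀ z, |h z| ≤ C) :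
    Integrable (fun z : Eu d => ‖z‖ ^ (-s) * h z) volume := by
  have := eu_nontrivial hd
  have hball : IntegrableOn (fun z : Eu d => ‖z‖ ^ (-s)) (Metric.ball 0 1) volume := by
    rw [integrableOn_fun_norm_addHaar volume (f := fun r : ℝ => r ^ (-s))]
    have h1 : IntegrableOn (fun r : ℝ => r ^ ((d : ℝ) - 1 - s)) (Ioo 0 1) volume := by
      rw [intervalIntegral.integrableOn_Ioo_rpow_iff one_pos]
      linarith
    refine h1.congr_fun (fun r hr => ?_) measurableSet_Ioo
    have hr0 : (0 : ℝ) < r := hr.1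
    simp only [finrank_euclideanSpace, Fintype.card_fin, smul_eq_mul]
    rw [← Real.rpow_natCast, ← Real.rpow_add hr0, Nat.cast_sub (by omega)]
    congr 1
    push_cast
    ring
  have hdom : Integrable (fun z : Eu d =>
      (Metric.ball 0 1).indicator (fun z : Eu d => ‖z‖ ^ (-s)) z * C + |h z|) volume :=
    ((hball.integrable_indicator measurableSet_ball).mul_const C).add hi.abs
  refine hdom.mono' ?_ (Eventually.of_forall fun z => ?_)
  · exact (by fun_prop : Measurable fun z : Eu d => ‖z‖ ^ (-s)).aestronglyMeasurable.mul
      hi.aestronglyMeasurable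
  · have hp : 0 ≤ ‖z‖ ^ (-s) := by positivity
    rw [Real.norm_eq_abs, abs_mul, abs_of_nonneg hp]
    by_cases hz : z ∈ Metric.ball (0 : Eu d) 1
    · rw [indicator_of_mem hz]
      have := mul_le_mul_of_nonneg_left (hC z) hp
      have := abs_nonneg (h z)
      linarith
    · rw [indicator_of_notMem hz]
      have hz1 : 1 ≤ ‖z‖ := by simpa using hz
      have : ‖z‖ ^ (-s) ≤ 1 := Real.rpow_le_one_of_one_le_of_nonpos hz1 (by linarith)
      have := mul_le_mul_of_nonneg_right this (abs_nonneg (h z))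
      linarith

lemma schwartz_bdd {d : ℕ} (h : 𝓢(Eu d, ℝ)) : ∃ C, ∀ z, |h z| ≤ C := by
  obtain ⟨C, _, hC⟩ := h.decay 0 0
  exact ⟨C, fun z => by simpa using hC z⟩

lemma integrable_ker1 {d : ℕ} (hd : 3 ≤ d) (h : 𝓢(Eu d, ℝ)) :
    Integrable (fun z : Eu d => ‖z‖ ^ ((2 : ℝ) - d) * h z) volume := by
  obtain ⟨C, hC⟩ := schwartz_bdd h
  have hd' : (3 : ℝ) ≤ d := by exact_mod_cast hd
  simpa using integrable_ker hd (s := (d : ℝ) - 2) (by linarith) (by linarith) h.integrable hC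

lemma integrable_ker2' {d : ℕ} (hd : 3 ≤ d) (h : 𝓢(Eu d, ℝ)) :
    Integrable (fun z : Eu d => ‖z‖ ^ ((1 : ℝ) - d) * h z) volume := by
  obtain ⟨C, hC⟩ := schwartz_bdd h
  have hd' : (3 : ℝ) ≤ d := by exact_mod_cast hd
  simpa using integrable_ker hd (s := (d : ℝ) - 1) (by linarith) (by linarith) h.integrable hC

lemma ker2_bound {d : ℕ} (e z : Eu d) {r : ℝ} (hr0 : 0 ≤ r)
    (hr : r ≤ ‖z‖ ^ (-(d : ℝ))) (u : ℝ) :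
    ‖r * ⟪z, e⟫ * u‖ ≤ ‖e‖ * ‖‖z‖ ^ ((1 : ℝ) - d) * u‖ := by
  rcases eq_or_ne z 0 with rfl | hz
  · simp only [inner_zero_left, mul_zero, zero_mul, norm_zero]; positivity
  have hz0 : 0 < ‖z‖ := norm_pos_iff.2 hz
  have h1 : ‖z‖ ^ ((1 : ℝ) - d) = ‖z‖ ^ (-(d : ℝ)) * ‖z‖ := by
    rw [sub_eq_add_neg, add_comm, Real.rpow_add hz0, Real.rpow_one]
  rw [norm_mul, norm_mul, norm_mul, Real.norm_of_nonneg hr0,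
    Real.norm_of_nonneg (by positivity : 0 ≤ ‖z‖ ^ ((1 : ℝ) - d)), h1]
  have h2 : ‖⟪z, e⟫‖ ≤ ‖z‖ * ‖e‖ := norm_inner_le_norm z e
  calc r * ‖⟪z, e⟫‖ * ‖u‖ ≤ ‖z‖ ^ (-(d : ℝ)) * (‖z‖ * ‖e‖) * ‖u‖ := by gcongr
    _ = _ := by ring

lemma integrable_ker2 {d : ℕ} (hd : 3 ≤ d) (h : 𝓢(Eu d, ℝ)) (e : Eu d) :
    Integrable (fun z : Eu d => ‖z‖ ^ (-(d : ℝ)) * ⟪z, e⟫ * h z) volume := by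
  refine ((integrable_ker2' hd h).norm.const_mul ‖e‖).mono' ?_ (Eventually.of_forall fun z => ?_)
  · exact (by fun_prop : Measurable fun z : Eu d =>
      ‖z‖ ^ (-(d : ℝ)) * ⟪z, e⟫ * h z).aestronglyMeasurable
  · exact ker2_bound e z (by positivity) le_rfl _

lemma ibp_eps {d : ℕ} (hd : 3 ≤ d) (h : 𝓢(Eu d, ℝ)) (e : Eu d) {ε : ℝ} (hε : 0 < ε) :
    ∫ z : Eu d, (‖z‖ ^ 2 + ε) ^ (((2 : ℝ) - d) / 2) * ∂_{e} h z =
      -∫ z : Eu d, (2 - (d : ℝ)) * ((‖z‖ ^ 2 + ε) ^ (-(d : ℝ) / 2) * ⟪z, e⟫ * h z) := by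
  have hd' : (3 : ℝ) ≤ d := by exact_mod_cast hd
  have hpos : ∀ z : Eu d, 0 < ‖z‖ ^ 2 + ε := fun z => by positivity
  have hder : ∀ z : Eu d, HasFDerivAt (fun z : Eu d => (‖z‖ ^ 2 + ε) ^ (((2 : ℝ) - d) / 2))
      (((((2 : ℝ) - d) / 2) * (‖z‖ ^ 2 + ε) ^ (((2 : ℝ) - d) / 2 - 1)) •
        (2 • (innerSL ℝ z))) z := fun z =>
    (((hasStrictFDerivAt_norm_sq z).hasFDerivAt).add_const ε).rpow_const (Or.inl (hpos z).ne')
  have hval : ∀ z : Eu d, fderiv ℝ (fun z : Eu d => (‖z‖ ^ 2 + ε) ^ (((2 : ℝ) - d) / 2)) z e =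
      (2 - (d : ℝ)) * ((‖z‖ ^ 2 + ε) ^ (-(d : ℝ) / 2) * ⟪z, e⟫) := fun z => by
    rw [(hder z).fderiv]
    have : ((2 : ℝ) - d) / 2 - 1 = -(d : ℝ) / 2 := by ring
    rw [this]
    simp
    ring
  have hbd : ∀ z : Eu d, (‖z‖ ^ 2 + ε) ^ (((2 : ℝ) - d) / 2) ≤ ε ^ (((2 : ℝ) - d) / 2) :=
    fun z => Real.rpow_le_rpow_of_nonpos hε (by nlinarith [sq_nonneg ‖z‖]) (by linarith)
  have hc : ∀ a : ℝ, Continuous fun z : Eu d => (‖z‖ ^ 2 + ε) ^ a := fun a =>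
    Continuous.rpow_const (by fun_prop) fun z => Or.inl (hpos z).ne'
  have hi : ∀ u : 𝓢(Eu d, ℝ), Integrable (fun z : Eu d =>
      (‖z‖ ^ 2 + ε) ^ (((2 : ℝ) - d) / 2) * u z) volume := fun u => by
    refine (u.integrable.norm.const_mul (ε ^ (((2 : ℝ) - d) / 2))).mono'
      ((hc _).mul u.continuous).aestronglyMeasurable (Eventually.of_forall fun z => ?_)
    rw [norm_mul, Real.norm_of_nonneg (by have := hpos z; positivity)]
    exact mul_le_mul_of_nonneg_right (hbd z) (norm_nonneg _)
  have key := integral_mul_fderiv_eq_neg_fderiv_mul_of_integrable (μ := (volume : Measure (Eu d)))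
    (f := fun z : Eu d => (‖z‖ ^ 2 + ε) ^ (((2 : ℝ) - d) / 2)) (g := h) (v := e) ?_ ?_ (hi h)
    (fun z _ => (hder z).differentiableAt) (fun z _ => h.differentiableAt)
  · simp only [hval] at key
    simp only [SchwartzMap.lineDerivOp_apply_eq_fderiv]
    rw [key]
    congr 1
    refine integral_congr_ae (Eventually.of_forall fun z => ?_)
    ring
  · simp only [hval]
    refine (((integrable_ker2' hd h).norm.const_mul ‖e‖).const_mul |2 - (d : ℝ)|).mono' ?_ ?_
    · exact ((continuous_const.mul ((hc _).mul (by fun_prop))).mul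
        h.continuous).aestronglyMeasurable
    · have := eu_nontrivial hd
      filter_upwards [compl_mem_ae_iff.2 (measure_singleton (0 : Eu d))] with z hz
      have hz0 : 0 < ‖z‖ := norm_pos_iff.2 hz
      rw [mul_assoc, norm_mul, Real.norm_eq_abs]
      gcongr
      refine ker2_bound e z (by have := hpos z; positivity) ?_ _
      have : ‖z‖ ^ (-(d : ℝ)) = (‖z‖ ^ 2) ^ (-(d : ℝ) / 2) := by
        rw [← Real.rpow_natCast, ← Real.rpow_mul hz0.le]; congr 1; push_cast; ring
      rw [this]
      exact Real.rpow_le_rpow_of_nonpos (by positivity) (by linarith) (by linarith)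
  · simpa only [SchwartzMap.lineDerivOp_apply_eq_fderiv] using hi (∂_{e} h)

lemma ibp_zero {d : ℕ} (hd : 3 ≤ d) (h : 𝓢(Eu d, ℝ)) (e : Eu d) :
    ∫ z : Eu d, ‖z‖ ^ ((2 : ℝ) - d) * ∂_{e} h z =
      ((d : ℝ) - 2) * ∫ z : Eu d, ‖z‖ ^ (-(d : ℝ)) * ⟪z, e⟫ * h z := by
  have hd' : (3 : ℝ) ≤ d := by exact_mod_cast hd
  have := eu_nontrivial hd
  have hε : ∀ n : ℕ, (0 : ℝ) < 1 / ((n : ℝ) + 1) := fun n => by positivity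
  have hlim : Tendsto (fun n : ℕ => 1 / ((n : ℝ) + 1)) atTop (𝓝 0) :=
    tendsto_one_div_add_atTop_nhds_zero_nat
  have hpw : ∀ (z : Eu d) (a : ℝ), 0 < ‖z‖ → ‖z‖ ^ a = (‖z‖ ^ 2) ^ (a / 2) := fun z a hz => by
    rw [← Real.rpow_natCast, ← Real.rpow_mul hz.le]; congr 1; push_cast; ring
  have hconv : ∀ (z : Eu d) (a : ℝ), 0 < ‖z‖ →
      Tendsto (fun n : ℕ => (‖z‖ ^ 2 + 1 / ((n : ℝ) + 1)) ^ (a / 2)) atTop (𝓝 (‖z‖ ^ a)) := by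
    intro z a hz
    rw [hpw z a hz]
    have : Tendsto (fun n : ℕ => ‖z‖ ^ 2 + 1 / ((n : ℝ) + 1)) atTop (𝓝 (‖z‖ ^ 2)) := by
      simpa using hlim.const_add (‖z‖ ^ 2)
    exact this.rpow_const (Or.inl (by positivity))
  have hle : ∀ (z : Eu d) (a : ℝ) (n : ℕ), 0 < ‖z‖ → a ≤ 0 →
      (‖z‖ ^ 2 + 1 / ((n : ℝ) + 1)) ^ (a / 2) ≤ ‖z‖ ^ a := by
    intro z a n hz ha
    rw [hpw z a hz]
    exact Real.rpow_le_rpow_of_nonpos (by positivity) (by linarith [hε n]) (by linarith)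
  have h1 : Tendsto (fun n : ℕ => ∫ z : Eu d,
      (‖z‖ ^ 2 + 1 / ((n : ℝ) + 1)) ^ (((2 : ℝ) - d) / 2) * ∂_{e} h z) atTop
      (𝓝 (∫ z : Eu d, ‖z‖ ^ ((2 : ℝ) - d) * ∂_{e} h z)) := by
    refine tendsto_integral_of_dominated_convergence _ (fun n => ?_)
      (integrable_ker1 hd (∂_{e} h)).norm (fun n => ?_) ?_
    · exact (by fun_prop : Measurable fun z : Eu d =>
        (‖z‖ ^ 2 + 1 / ((n : ℝ) + 1)) ^ (((2 : ℝ) - d) / 2)).aestronglyMeasurable.mul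
          (∂_{e} h).continuous.aestronglyMeasurable
    · filter_upwards [compl_mem_ae_iff.2 (measure_singleton (0 : Eu d))] with z hz
      have hz0 : 0 < ‖z‖ := norm_pos_iff.2 hz
      rw [norm_mul, norm_mul, Real.norm_of_nonneg
        (by positivity : 0 ≤ (‖z‖ ^ 2 + 1 / ((n : ℝ) + 1)) ^ (((2 : ℝ) - d) / 2)),
        Real.norm_of_nonneg (by positivity : 0 ≤ ‖z‖ ^ ((2 : ℝ) - d))]
      exact mul_le_mul_of_nonneg_right (hle z _ n hz0 (by linarith)) (norm_nonneg _)
    · filter_upwards [compl_mem_ae_iff.2 (measure_singleton (0 : Eu d))] with z hz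
      exact (hconv z _ (norm_pos_iff.2 hz)).mul_const _
  have h2 : Tendsto (fun n : ℕ => ∫ z : Eu d,
      (‖z‖ ^ 2 + 1 / ((n : ℝ) + 1)) ^ (-(d : ℝ) / 2) * ⟪z, e⟫ * h z) atTop
      (𝓝 (∫ z : Eu d, ‖z‖ ^ (-(d : ℝ)) * ⟪z, e⟫ * h z)) := by
    refine tendsto_integral_of_dominated_convergence _ (fun n => ?_)
      ((integrable_ker2' hd h).norm.const_mul ‖e‖) (fun n => ?_) ?_
    · exact (by fun_prop : Measurable fun z : Eu d =>
        (‖z‖ ^ 2 + 1 / ((n : ℝ) + 1)) ^ (-(d : ℝ) / 2) * ⟪z, e⟫).aestronglyMeasurable.mul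
          h.continuous.aestronglyMeasurable
    · filter_upwards [compl_mem_ae_iff.2 (measure_singleton (0 : Eu d))] with z hz
      exact ker2_bound e z (by positivity) (hle z _ n (norm_pos_iff.2 hz) (by linarith)) _
    · filter_upwards [compl_mem_ae_iff.2 (measure_singleton (0 : Eu d))] with z hz
      exact ((hconv z _ (norm_pos_iff.2 hz)).mul_const _).mul_const _
  have h3 := (h2.const_mul ((d : ℝ) - 2))
  refine tendsto_nhds_unique h1 (h3.congr fun n => ?_)
  rw [ibp_eps hd h e (hε n), integral_const_mul]
  ring

lemma canE_inner {d : ℕ} (j : Fin d) (v : Eu d) : ⟪canE d j, v⟫ = v j := by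
  simp [canE, EuclideanSpace.inner_single_left]

lemma sum_canE {d : ℕ} (v : Eu d) : ∑ j, ⟪canE d j, v⟫ • canE d j = v := by
  have := (EuclideanSpace.basisFun (Fin d) ℝ).sum_repr' v
  simpa [canE] using this

lemma integrable_of_comp {d : ℕ} {V : Eu d → Eu d}
    (h : ∀ j, Integrable (fun y => ⟪canE d j, V y⟫) volume) : Integrable V volume := by
  have : V = fun y => ∑ j, ⟪canE d j, V y⟫ • canE d j := by
    funext y; rw [sum_canE]
  rw [this]
  exact integrable_finsetSum _ fun j _ => (h j).smul_const _

lemma fderiv_self_sum {d : ℕ} (h : 𝓢(Eu d, ℝ)) (y z : Eu d) :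
    fderiv ℝ h y z = ∑ j, ⟪z, canE d j⟫ * ∂_{canE d j} h y := by
  conv_lhs => rw [← sum_canE z]
  rw [map_sum]
  refine Finset.sum_congr rfl fun j _ => ?_
  rw [map_smul, SchwartzMap.lineDerivOp_apply_eq_fderiv, smul_eq_mul, real_inner_comm]

lemma integrable_radial {d : ℕ} (hd : 3 ≤ d) (h : 𝓢(Eu d, ℝ)) :
    Integrable (fun z : Eu d => ‖z‖ ^ (-(d : ℝ)) * fderiv ℝ h z z) volume := by
  have : (fun z : Eu d => ‖z‖ ^ (-(d : ℝ)) * fderiv ℝ h z z) =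
      fun z => ∑ j, ‖z‖ ^ (-(d : ℝ)) * ⟪z, canE d j⟫ * ∂_{canE d j} h z := by
    funext z
    rw [fderiv_self_sum, Finset.mul_sum]
    exact Finset.sum_congr rfl fun j _ => by ring
  rw [this]
  exact integrable_finsetSum _ fun j _ => integrable_ker2 hd _ _

lemma ray_integral {d : ℕ} (h : 𝓢(Eu d, ℝ)) {s : Eu d} (hs : ‖s‖ = 1) :
    ∫ r in Ioi (0 : ℝ), fderiv ℝ h (r • s) s = - h 0 := by
  have hanti : AntilipschitzWith 1 (fun r : ℝ => r • s) := by
    refine AntilipschitzWith.of_le_mul_dist fun a b => ?_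
    rw [dist_eq_norm, dist_eq_norm, ← sub_smul, norm_smul, hs]
    simp
  let g : 𝓢(ℝ, ℝ) := SchwartzMap.compCLMOfAntilipschitz ℝ (g := fun r : ℝ => r • s)
    (by fun_prop) hanti h
  have hg : ∀ r : ℝ, HasDerivAt g (fderiv ℝ h (r • s) s) r := fun r => by
    have h1 : HasDerivAt (fun r : ℝ => r • s) s r := by
      simpa using (hasDerivAt_id r).smul_const s
    exact (h.hasFDerivAt (r • s)).comp_hasDerivAt r h1
  have h_int : Integrable (fun r : ℝ => fderiv ℝ h (r • s) s) volume := by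
    have := (SchwartzMap.derivCLM ℝ ℝ g).integrable (μ := volume)
    refine this.congr (Eventually.of_forall fun r => ?_)
    rw [SchwartzMap.derivCLM_apply, (hg r).deriv]
  have hlim : Tendsto g atTop (𝓝 0) := by
    have := g.toZeroAtInfty.zero_at_infty'
    exact this.mono_left atTop_le_cocompact
  rw [integral_Ioi_of_hasDerivAt_of_tendsto' (fun r _ => hg r) h_int.integrableOn hlim]
  have : g 0 = h ((0 : ℝ) • s) := rfl
  rw [this]; simp

lemma polar {d : ℕ} (hd : 3 ≤ d) (h : 𝓢(Eu d, ℝ)) :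
    ∫ z : Eu d, ‖z‖ ^ (-(d : ℝ)) * fderiv ℝ h z z =
      -((volume : Measure (Eu d)).toSphere.real univ * h 0) := by
  have := eu_nontrivial hd
  set k : Eu d → ℝ := fun z => ‖z‖ ^ (-(d : ℝ)) * fderiv ℝ h z z with hk
  have hmp := (volume : Measure (Eu d)).measurePreserving_homeomorphUnitSphereProd
  have hemb := (homeomorphUnitSphereProd (Eu d)).measurableEmbedding
  have hcomp : ∀ z : ({(0)}ᶜ : Set (Eu d)),
      k ((homeomorphUnitSphereProd (Eu d) z).2.1 • (homeomorphUnitSphereProd (Eu d) z).1.1)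
        = k z.1 := by
    intro z
    congr 1
    have hz : ‖z.1‖ ≠ 0 := norm_ne_zero_iff.2 z.2
    simp [smul_smul, hz]
  have h_int : Integrable (fun p : Metric.sphere (0 : Eu d) 1 × Ioi (0 : ℝ) => k (p.2.1 • p.1.1))
      ((volume : Measure (Eu d)).toSphere.prod
        (Measure.volumeIoiPow (Module.finrank ℝ (Eu d) - 1))) := by
    rw [← hmp.integrable_comp_emb hemb]
    have h1 : Integrable k volume := integrable_radial hd h
    rw [← restrict_compl_singleton (μ := (volume : Measure (Eu d))) 0, ← IntegrableOn,
      integrableOn_iff_comap_subtypeVal (by measurability)] at h1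
    refine h1.congr (Eventually.of_forall fun z => ?_)
    exact (hcomp z).symm
  calc ∫ z, k z = ∫ z : ({(0)}ᶜ : Set (Eu d)), k z.1 ∂((volume : Measure (Eu d)).comap Subtype.val) := by
        rw [integral_subtype_comap (measurableSet_singleton _).compl k, restrict_compl_singleton]
    _ = ∫ p : Metric.sphere (0 : Eu d) 1 × Ioi (0 : ℝ), k (p.2.1 • p.1.1)
          ∂((volume : Measure (Eu d)).toSphere.prod
            (Measure.volumeIoiPow (Module.finrank ℝ (Eu d) - 1))) := by
        rw [← hmp.integral_comp hemb]
        exact integral_congr_ae (Eventually.of_forall fun z => (hcomp z).symm)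
    _ = ∫ s : Metric.sphere (0 : Eu d) 1, -h 0 ∂(volume : Measure (Eu d)).toSphere := by
        rw [integral_prod _ h_int]
        refine integral_congr_ae (Eventually.of_forall fun s => ?_)
        have hs : ‖s.1‖ = 1 := by simp
        simp only [Measure.volumeIoiPow, ENNReal.ofReal]
        rw [integral_withDensity_eq_integral_smul
            ((measurable_subtype_coe.pow_const _).real_toNNReal),
          integral_subtype_comap measurableSet_Ioi fun a : ℝ ↦
            Real.toNNReal (a ^ (Module.finrank ℝ (Eu d) - 1)) • k (a • s.1),
          ← ray_integral h hs]
        refine setIntegral_congr_fun measurableSet_Ioi fun r hr => ?_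
        have hr0 : (0 : ℝ) < r := hr
        simp only [hk]
        rw [NNReal.smul_def, Real.coe_toNNReal _ (pow_nonneg hr0.le _), norm_smul, hs,
          Real.norm_of_nonneg hr0.le, mul_one, map_smul, smul_eq_mul, smul_eq_mul,
          finrank_euclideanSpace, Fintype.card_fin, Real.rpow_neg hr0.le, Real.rpow_natCast]
        have : r ^ d = r ^ (d - 1) * r := by
          rw [← pow_succ]; congr 1; omega
        rw [this]
        field_simp
    _ = _ := by
        rw [integral_const, smul_eq_mul]; ring

/-- `z ↦ φ (x - z)` as a Schwartz map. -/
def reflS {d : ℕ} (x : Eu d) (φ : 𝓢(Eu d, ℝ)) : 𝓢(Eu d, ℝ) :=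
  SchwartzMap.compCLMOfAntilipschitz (g := fun z : Eu d => x - z) (K := 1) ℝ (by fun_prop)
    (AntilipschitzWith.of_le_mul_dist fun a b ↦ by
      rw [dist_sub_left]; simp) φ

lemma reflS_apply {d : ℕ} (x : Eu d) (φ : 𝓢(Eu d, ℝ)) (z : Eu d) : reflS x φ z = φ (x - z) := rfl

lemma reflS_fderiv {d : ℕ} (x : Eu d) (φ : 𝓢(Eu d, ℝ)) (z e : Eu d) :
    fderiv ℝ (reflS x φ) z e = - fderiv ℝ φ (x - z) e := by
  have h1 : HasFDerivAt (fun z : Eu d => x - z) (-(ContinuousLinearMap.id ℝ (Eu d))) z :=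
    (hasFDerivAt_id z).const_sub x
  have h2 : HasFDerivAt (reflS x φ) _ z := (φ.hasFDerivAt (x - z)).comp z h1
  rw [h2.fderiv]; simp

lemma int1 {d : ℕ} (hd : 3 ≤ d) (φ : 𝓢(Eu d, ℝ)) (x : Eu d) :
    Integrable (fun y : Eu d => ‖x - y‖ ^ ((2 : ℝ) - d) * φ y) volume := by
  have := (integrable_ker1 hd (reflS x φ)).comp_sub_left x
  simpa [reflS_apply] using this

lemma int2 {d : ℕ} (hd : 3 ≤ d) (φ : 𝓢(Eu d, ℝ)) (x e : Eu d) :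
    Integrable (fun y : Eu d => ‖x - y‖ ^ (-(d : ℝ)) * ⟪x - y, e⟫ * φ y) volume := by
  have := (integrable_ker2 hd (reflS x φ) e).comp_sub_left x
  simpa only [reflS_apply, sub_sub_cancel] using this

lemma ibp_x {d : ℕ} (hd : 3 ≤ d) (φ : 𝓢(Eu d, ℝ)) (x e : Eu d) :
    ∫ y : Eu d, ‖x - y‖ ^ ((2 : ℝ) - d) * ∂_{e} φ y =
      (2 - (d : ℝ)) * ∫ y : Eu d, ‖x - y‖ ^ (-(d : ℝ)) * ⟪x - y, e⟫ * φ y := by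
  have h := ibp_zero hd (reflS x φ) e
  rw [← integral_sub_left_eq_self _ volume x,
    ← integral_sub_left_eq_self (fun z : Eu d => ‖z‖ ^ (-(d : ℝ)) * _ * _) volume x] at h
  simp only [SchwartzMap.lineDerivOp_apply_eq_fderiv, reflS_fderiv, reflS_apply, sub_sub_cancel,
    mul_neg, integral_neg] at h ⊢
  linarith

lemma green {d : ℕ} (hd : 3 ≤ d) (f : 𝓢(Eu d, ℝ)) (x : Eu d) :
    ∫ y : Eu d, ‖x - y‖ ^ ((2 : ℝ) - d) * ∑ j, ∂_{canE d j} (∂_{canE d j} f) y =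
      (2 - (d : ℝ)) * ((volume : Measure (Eu d)).toSphere.real univ * f x) := by
  have h := polar hd (reflS x f)
  rw [← integral_sub_left_eq_self _ volume x] at h
  simp only [reflS_fderiv, reflS_apply, sub_sub_cancel, mul_neg, integral_neg, sub_zero,
    neg_inj] at h
  simp only [Finset.mul_sum]
  rw [integral_finsetSum _ fun j _ => int1 hd _ x, ← h]
  simp only [ibp_x hd]
  rw [← Finset.mul_sum, ← integral_finsetSum _ fun j _ => int2 hd _ x _]
  congr 1
  refine integral_congr_ae (Eventually.of_forall fun y => ?_)
  simp only
  rw [fderiv_self_sum, Finset.mul_sum]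
  exact Finset.sum_congr rfl fun j _ => by ring

/-- The constant in the fundamental solution. -/
def cG (d : ℕ) : ℝ := -(Real.Gamma ((d : ℝ) / 2 - 1) / (4 * Real.pi ^ ((d : ℝ) / 2)))

lemma cG_mul {d : ℕ} (hd : 3 ≤ d) :
    cG d * ((2 - (d : ℝ)) * (volume : Measure (Eu d)).toSphere.real univ) = 1 := by
  have hd' : (3 : ℝ) ≤ d := by exact_mod_cast hd
  have := eu_nontrivial hd
  have : Nonempty (Fin d) := ⟨⟨0, by omega⟩⟩
  have hpi : √π ^ d = π ^ ((d : ℝ) / 2) := by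
    rw [Real.sqrt_eq_rpow, ← Real.rpow_natCast, ← Real.rpow_mul Real.pi_pos.le]
    congr 1; ring
  have hG1 : Real.Gamma ((d : ℝ) / 2 + 1) =
      (d / 2) * ((d / 2 - 1) * Real.Gamma ((d : ℝ) / 2 - 1)) := by
    rw [Real.Gamma_add_one (by linarith), ← Real.Gamma_add_one (s := (d : ℝ) / 2 - 1) (by linarith),
      sub_add_cancel]
  have hGp : 0 < Real.Gamma ((d : ℝ) / 2 - 1) := Real.Gamma_pos_of_pos (by linarith)
  have hGp' : 0 < Real.Gamma ((d : ℝ) / 2 + 1) := Real.Gamma_pos_of_pos (by linarith)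
  have hpp : 0 < π ^ ((d : ℝ) / 2) := Real.rpow_pos_of_pos Real.pi_pos _
  rw [Measure.toSphere_real_apply_univ, finrank_euclideanSpace, Fintype.card_fin, measureReal_def,
    EuclideanSpace.volume_ball, Fintype.card_fin, hpi, ENNReal.ofReal_one, one_pow, one_mul,
    ENNReal.toReal_ofReal (by positivity), hG1, cG]
  have h1 : (d : ℝ) / 2 - 1 ≠ 0 := by linarith
  have h2 : (d : ℝ) - 2 ≠ 0 := by linarith
  generalize Real.Gamma ((d : ℝ) / 2 - 1) = g at hGp
  field_simp
  ring

lemma grad_fundSol {d : ℕ} {z : Eu d} (hz : z ≠ 0) (e : Eu d) :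
    ⟪e, gradient (fundSol d) z⟫ = cG d * (2 - (d : ℝ)) * (‖z‖ ^ (-(d : ℝ)) * ⟪z, e⟫) := by
  have hz0 : 0 < ‖z‖ := norm_pos_iff.2 hz
  have hpw : ∀ (z : Eu d) (a : ℝ), (‖z‖ ^ 2) ^ (a / 2) = ‖z‖ ^ a := fun z a => by
    rw [← Real.rpow_natCast, ← Real.rpow_mul (norm_nonneg z)]; congr 1; push_cast; ring
  have hder : HasFDerivAt (fun z : Eu d => cG d * (‖z‖ ^ 2) ^ (((2 : ℝ) - d) / 2))
      (cG d • (((((2 : ℝ) - d) / 2) * (‖z‖ ^ 2) ^ (((2 : ℝ) - d) / 2 - 1)) •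
        (2 • (innerSL ℝ z)))) z :=
    (((hasStrictFDerivAt_norm_sq z).hasFDerivAt).rpow_const (Or.inl (by positivity))).const_mul _
  have hfs : (fun z : Eu d => cG d * (‖z‖ ^ 2) ^ (((2 : ℝ) - d) / 2)) = fundSol d := by
    funext z; rw [hpw]; rfl
  rw [hfs] at hder
  have h1 : ⟪e, gradient (fundSol d) z⟫ = fderiv ℝ (fundSol d) z e := by
    rw [real_inner_comm, gradient, InnerProductSpace.toDual_symm_apply]
  have h2 : ((2 : ℝ) - d) / 2 - 1 = (-(d : ℝ)) / 2 := by ring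
  rw [h1, hder.fderiv, h2, hpw]
  simp
  ring

/-- reconstruction of the field from `Φ = div F` and the componentwise
Laplacian `Ψ` of its solenoidal part: `F = Φ ∗ ∇G + G ∗ Ψ`, both integrals converging. -/
theorem stmt15 (d : ℕ) (hd : 3 ≤ d)
    (F : EuclideanSpace ℝ (Fin d) → EuclideanSpace ℝ (Fin d))
    (hF : ∀ j : Fin d, IsSchwartz (fun x => ⟪canE d j, F x⟫))
    (Φ : EuclideanSpace ℝ (Fin d) → ℝ) (hΦ : ∀ x, Φ x = vdiv F x)
    (Ψ : EuclideanSpace ℝ (Fin d) → EuclideanSpace ℝ (Fin d))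
    (hΨ : ∀ (j : Fin d) x,
      ⟪canE d j, Ψ x⟫ = lap (fun y => ⟪canE d j, F y⟫) x - fderiv ℝ Φ x (canE d j)) :
    ∀ x : EuclideanSpace ℝ (Fin d),
      Integrable (fun y => Φ y • gradient (fundSol d) (x - y)) volume ∧
      Integrable (fun y => fundSol d (x - y) • Ψ y) volume ∧
      F x = (∫ y, Φ y • gradient (fundSol d) (x - y)) +
              ∫ y, fundSol d (x - y) • Ψ y := by
  intro x
  have := eu_nontrivial hd
  choose f hf using hF
  have hf' : ∀ j, (fun x => ⟪canE d j, F x⟫) = f j := fun j => funext (hf j)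
  let φ : 𝓢(Eu d, ℝ) := ∑ j, ∂_{canE d j} (f j)
  have hφ : Φ = φ := by
    funext y
    rw [hΦ, vdiv]
    simp only [hf', φ, sum_apply, SchwartzMap.lineDerivOp_apply_eq_fderiv]
  have hlap : ∀ j y, lap (fun y => ⟪canE d j, F y⟫) y =
      ∑ i, ∂_{canE d i} (∂_{canE d i} (f j)) y := by
    intro j y
    rw [lap, hf']
    refine Finset.sum_congr rfl fun i _ => ?_
    rw [SchwartzMap.lineDerivOp_apply_eq_fderiv]
    congr 2
  have hΨ' : ∀ j y, ⟪canE d j, Ψ y⟫ =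
      ∑ i, ∂_{canE d i} (∂_{canE d i} (f j)) y - ∂_{canE d j} φ y := by
    intro j y
    rw [hΨ, hlap, hφ, SchwartzMap.lineDerivOp_apply_eq_fderiv]
  have hI2 : ∀ j y, ⟪canE d j, fundSol d (x - y) • Ψ y⟫ =
      cG d * (‖x - y‖ ^ ((2 : ℝ) - d) * ∑ i, ∂_{canE d i} (∂_{canE d i} (f j)) y) -
      cG d * (‖x - y‖ ^ ((2 : ℝ) - d) * ∂_{canE d j} φ y) := by
    intro j y
    rw [inner_smul_right, hΨ', fundSol, ← cG]
    ring
  have hI1 : ∀ j, (fun y => ⟪canE d j, Φ y • gradient (fundSol d) (x - y)⟫) =ᵐ[volume]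
      fun y => cG d * (2 - (d : ℝ)) *
        (‖x - y‖ ^ (-(d : ℝ)) * ⟪x - y, canE d j⟫ * φ y) := by
    intro j
    filter_upwards [compl_mem_ae_iff.2 (measure_singleton x)] with y hy
    have hz : x - y ≠ 0 := sub_ne_zero.2 (Ne.symm hy)
    rw [inner_smul_right, grad_fundSol hz, hφ]
    ring
  have hA : ∀ j, Integrable (fun y : Eu d => cG d * (‖x - y‖ ^ ((2 : ℝ) - d) *
      ∑ i, ∂_{canE d i} (∂_{canE d i} (f j)) y)) volume := by
    intro j
    have := (int1 hd (∑ i, ∂_{canE d i} (∂_{canE d i} (f j))) x).const_mul (cG d)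
    simpa only [sum_apply] using this
  have hB : ∀ j, Integrable (fun y : Eu d => cG d * (‖x - y‖ ^ ((2 : ℝ) - d) *
      ∂_{canE d j} φ y)) volume := fun j => (int1 hd _ x).const_mul (cG d)
  have int_1 : Integrable (fun y => Φ y • gradient (fundSol d) (x - y)) volume :=
    integrable_of_comp fun j => ((int2 hd φ x (canE d j)).const_mul _).congr (hI1 j).symm
  have int_2 : Integrable (fun y => fundSol d (x - y) • Ψ y) volume := by
    refine integrable_of_comp fun j => ?_
    simp only [hI2]
    exact (hA j).sub (hB j)
  refine ⟨int_1, int_2, ?_⟩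
  ext j
  rw [← canE_inner, ← canE_inner, inner_add_right, ← integral_inner int_1, ← integral_inner int_2,
    integral_congr_ae (hI1 j)]
  simp only [hI2]
  rw [integral_sub (hA j) (hB j), integral_const_mul, integral_const_mul, integral_const_mul,
    green hd, ibp_x hd, show ⟪canE d j, F x⟫ = f j x from hf j x]
  linear_combination (-(f j x)) * cG_mul hd
end
end
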